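/- arXiv:2006.13667 — 2 statements merged into one kernel-verified Lean document; each statement's English description precedes it below -/
import Mathlib

section
/- Let $K$ be an algebraic number field of degree $n \geq 6$. Then for every $\varepsilon > 0$ there exists a constant $C > 0$ (depending on $K$ and $\varepsilon$) such that for every $X \geq \max(d_K^{1/2}, 2)$ there exists a real number $x_0$ with $X \leq x_0 \leq 2X$ satisfying $\left| \sum_{m \leq x_0} r_K(m) - \kappa_K x_0 \right| \leq C\, x_0^{1 - 3/n + \varepsilon}$. -/
open NumberField Filter Asymptotics Set MeasureTheory

/-- `rK K m` is the number of nonzero integral ideals of the ring of integers of `K`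
with absolute norm equal to `m` (for `m ≥ 1` the nonzero condition is automatic). -/
noncomputable def rK (K : Type*) [Field K] [NumberField K] (m : ℕ) : ℕ :=
  Nat.card {I : Ideal (𝓞 K) // Ideal.absNorm I = m}

/-- The exponential integral `E₁(X) = ∫_X^∞ e^{-t}/t dt`. -/
noncomputable def E1 (X : ℝ) : ℝ := ∫ t in Set.Ioi X, Real.exp (-t) / t

/-- A smooth cutoff, equal to `1` on `(-∞, 1]` and to `0` on `[4/3, ∞)`. -/
noncomputable def cutoff (t : ℝ) : ℝ := 1 - Real.smoothTransition (3 * (t - 1))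

/-- The summatory function of a sequence. -/
noncomputable def partialSum (r : ℕ → ℝ) (x : ℝ) : ℝ := ∑ m ∈ Finset.Icc 0 ⌊x⌋₊, r m

/-- The sum of a sequence up to `X`, smoothed by `cutoff`. -/
noncomputable def smoothSum (r : ℕ → ℝ) (X : ℝ) : ℝ := ∑' m : ℕ, r m * cutoff (m / X)

lemma contDiff_cutoff {n : ℕ∞} : ContDiff ℝ n cutoff :=
  contDiff_const.sub (Real.smoothTransition.contDiff.comp
    (contDiff_const.mul (contDiff_id.sub contDiff_const)))

lemma differentiable_cutoff : Differentiable ℝ cutoff :=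
  (contDiff_cutoff (n := 1)).differentiable (by norm_num)

lemma cutoff_of_le_one {t : ℝ} (ht : t ≤ 1) : cutoff t = 1 := by
  rw [cutoff, Real.smoothTransition.zero_of_nonpos (by linarith), sub_zero]

lemma cutoff_of_four_thirds_le {t : ℝ} (ht : 4 / 3 ≤ t) : cutoff t = 0 := by
  rw [cutoff, Real.smoothTransition.one_of_one_le (by linarith), sub_self]

lemma antitone_cutoff : Antitone cutoff := fun a b hab =>
  sub_le_sub_left (Real.smoothTransition.monotone (by linarith)) _

lemma smoothSum_eq_sum (r : ℕ → ℝ) {X b : ℝ} (hX : 0 < X) (hb : 4 / 3 * X ≤ b) :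
    smoothSum r X = ∑ m ∈ Finset.Icc 0 ⌊b⌋₊, cutoff (m / X) * r m := by
  rw [smoothSum, tsum_eq_sum (s := Finset.Icc 0 ⌊b⌋₊)]
  · exact Finset.sum_congr rfl fun m _ => mul_comm _ _
  · intro m hm
    have h : b < m := by
      simp only [Finset.mem_Icc, zero_le, true_and, not_le] at hm
      exact (Nat.floor_lt (by linarith)).1 hm
    rw [cutoff_of_four_thirds_le, mul_zero]
    rw [le_div_iff₀ hX]
    linarith

/-- The mass of `cutoff` on the positive axis. -/
noncomputable def cutoffMass : ℝ := ∫ t in (0 : ℝ)..(4 / 3), cutoff t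

lemma differentiable_cutoff_div (X : ℝ) : Differentiable ℝ fun t : ℝ => cutoff (t / X) :=
  differentiable_cutoff.comp (differentiable_id.div_const X)

lemma continuous_deriv_cutoff_div (X : ℝ) : Continuous (deriv fun t : ℝ => cutoff (t / X)) :=
  ((contDiff_cutoff (n := 1)).comp (contDiff_id.div_const X)).continuous_deriv (by norm_num)

lemma deriv_cutoff_div_nonpos {X : ℝ} (hX : 0 < X) (t : ℝ) :
    deriv (fun t : ℝ => cutoff (t / X)) t ≤ 0 :=
  Antitone.deriv_nonpos (g := fun t : ℝ => cutoff (t / X))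
    (antitone_cutoff.comp_monotone fun a b hab => by gcongr)

lemma deriv_cutoff_div_of_lt {X t : ℝ} (hX : 0 < X) (ht : t < X) :
    deriv (fun t : ℝ => cutoff (t / X)) t = 0 := by
  have : (fun t : ℝ => cutoff (t / X)) =ᶠ[nhds t] fun _ => 1 := by
    filter_upwards [Iio_mem_nhds ht] with s hs
    exact cutoff_of_le_one ((div_le_one hX).2 (le_of_lt hs))
  rw [this.deriv_eq, deriv_const]

lemma smoothSum_sub_le (r : ℕ → ℝ) (κ T : ℝ) {X : ℝ} (hX : 0 < X)
    (h : ∀ t, X ≤ t → t ≤ 4 / 3 * X → partialSum r t - κ * t ≤ T) :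
    smoothSum r X - κ * cutoffMass * X ≤ T := by
  set f : ℝ → ℝ := fun t => cutoff (t / X) with hf
  set b : ℝ := 4 / 3 * X with hb
  have hb0 : 0 ≤ b := by positivity
  have hfb : f b = 0 := cutoff_of_four_thirds_le (by rw [hb]; field_simp; rfl)
  have hf0 : f 0 = 1 := by simp only [hf, zero_div]; exact cutoff_of_le_one zero_le_one
  have hcont : Continuous (deriv f) := continuous_deriv_cutoff_div X
  have hint : IntegrableOn (deriv f) (Icc 0 b) := hcont.continuousOn.integrableOn_Icc
  have h1 : smoothSum r X = - ∫ t in (0 : ℝ)..b, deriv f t * partialSum r t := by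
    rw [smoothSum_eq_sum r hX le_rfl, sum_mul_eq_sub_integral_mul r (f := f) hb0
      (fun t _ => differentiable_cutoff_div X t) hint, hfb, zero_mul, zero_sub,
      intervalIntegral.integral_of_le hb0]
    rfl
  have h2 : cutoffMass * X = - ∫ t in (0 : ℝ)..b, deriv f t * t := by
    have := intervalIntegral.integral_mul_deriv_eq_deriv_mul (a := 0) (b := b)
      (u := fun t => t) (u' := fun _ => 1) (v := f) (v' := deriv f)
      (fun t _ => hasDerivAt_id' t) (fun t _ => (differentiable_cutoff_div X t).hasDerivAt)
      intervalIntegrable_const (hcont.intervalIntegrable _ _)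
    simp only [mul_comm (deriv f _)]
    rw [this, hfb]
    have h3 : ∫ t in (0 : ℝ)..b, f t = X * cutoffMass := by
      rw [hf, intervalIntegral.integral_comp_div _ hX.ne', cutoffMass, hb, zero_div,
        mul_div_assoc, div_self hX.ne', mul_one, smul_eq_mul]
    simp only [one_mul, h3]
    ring
  have h3 : T = ∫ t in (0 : ℝ)..b, - deriv f t * T := by
    rw [intervalIntegral.integral_mul_const, intervalIntegral.integral_neg,
      intervalIntegral.integral_deriv_eq_sub (fun t _ => differentiable_cutoff_div X t)
      (hcont.intervalIntegrable _ _)]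
    change T = -(f b - f 0) * T
    rw [hfb, hf0]; ring
  have hi1 : IntervalIntegrable (fun t => deriv f t * partialSum r t) volume 0 b := by
    rw [intervalIntegrable_iff_integrableOn_Icc_of_le hb0]
    exact integrableOn_mul_sum_Icc r le_rfl hint
  have hi2 : IntervalIntegrable (fun t => deriv f t * t) volume 0 b :=
    (hcont.mul continuous_id).intervalIntegrable _ _
  have h4 : smoothSum r X - κ * cutoffMass * X =
      ∫ t in (0 : ℝ)..b, - deriv f t * (partialSum r t - κ * t) := by
    rw [mul_assoc, h1, h2, mul_neg, ← intervalIntegral.integral_const_mul, sub_neg_eq_add,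
      neg_add_eq_sub, ← intervalIntegral.integral_sub (hi2.const_mul κ) hi1]
    exact intervalIntegral.integral_congr fun t _ => by ring
  rw [h4, h3]
  refine intervalIntegral.integral_mono_on hb0 ?_ ?_ ?_
  · refine ((hi2.const_mul κ).sub hi1).congr fun t _ => ?_
    ring
  · exact (hcont.neg.mul continuous_const).intervalIntegrable _ _
  · intro t ht
    rcases lt_or_ge t X with h5 | h5
    · simp [hf, deriv_cutoff_div_of_lt hX h5]
    · exact mul_le_mul_of_nonneg_left (h t h5 ht.2)
        (neg_nonneg.2 (deriv_cutoff_div_nonpos hX t))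

lemma le_smoothSum_sub (r : ℕ → ℝ) (κ T : ℝ) {X : ℝ} (hX : 0 < X)
    (h : ∀ t, X ≤ t → t ≤ 4 / 3 * X → T ≤ partialSum r t - κ * t) :
    T ≤ smoothSum r X - κ * cutoffMass * X := by
  have := smoothSum_sub_le (fun m => - r m) (-κ) (-T) hX fun t h1 h2 => by
    have := h t h1 h2
    simp only [partialSum, Finset.sum_neg_distrib] at this ⊢
    linarith
  simp only [smoothSum, neg_mul, tsum_neg] at this ⊢
  linarith

/-- Since `x ↦ ∑ m ≤ x, r m` is monotone, the error term cannot pass from nonnegative to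
nonpositive values without vanishing. -/
lemma exists_partialSum_eq {r : ℕ → ℝ} (hr : ∀ m, 0 ≤ r m) {κ : ℝ} {p q : ℝ}
    (hpq : p ≤ q) (hp : 0 ≤ partialSum r p - κ * p) (hq : partialSum r q - κ * q < 0) :
    ∃ z, p ≤ z ∧ z ≤ q ∧ partialSum r z - κ * z = 0 := by
  have hmono : Monotone (partialSum r) := fun a b hab =>
    Finset.sum_le_sum_of_subset_of_nonneg
      (Finset.Icc_subset_Icc_right (Nat.floor_le_floor hab)) fun m _ _ => hr m
  set s : Set ℝ := {t | p ≤ t ∧ t ≤ q ∧ 0 ≤ partialSum r t - κ * t} with hs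
  have hps : p ∈ s := ⟨le_rfl, hpq, hp⟩
  have hbdd : BddAbove s := ⟨q, fun t ht => ht.2.1⟩
  have hpz : p ≤ sSup s := le_csSup hbdd hps
  have hzq : sSup s ≤ q := csSup_le ⟨p, hps⟩ fun t ht => ht.2.1
  have h1 : κ * sSup s ≤ partialSum r (sSup s) := by
    obtain ⟨u, -, hu, hus⟩ := exists_seq_tendsto_sSup ⟨p, hps⟩ hbdd
    refine le_of_tendsto (hu.const_mul κ) (Eventually.of_forall fun n => ?_)
    have := hmono (le_csSup hbdd (hus n))
    linarith [(hus n).2.2]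
  have hlt : sSup s < q := lt_of_le_of_ne hzq fun h => by rw [h] at h1; linarith
  refine ⟨sSup s, hpz, hzq, le_antisymm ?_ (by linarith)⟩
  have h2 : partialSum r (sSup s) ≤ κ * sSup s := by
    have h3 : Tendsto (fun t : ℝ => κ * t) (nhdsWithin (sSup s) (Ioi (sSup s)))
        (nhds (κ * sSup s)) :=
      ((continuous_const.mul continuous_id).tendsto _).mono_left nhdsWithin_le_nhds
    refine ge_of_tendsto h3 ?_
    filter_upwards [Ioo_mem_nhdsGT hlt] with t ht
    by_contra! hcon
    have h4 : t ∈ s := ⟨hpz.trans ht.1.le, ht.2.le, by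
      have := hmono ht.1.le; linarith⟩
    exact absurd (le_csSup hbdd h4) (not_le.2 ht.1)
  linarith

lemma exists_abs_partialSum_sub_le {r : ℕ → ℝ} (hr : ∀ m, 0 ≤ r m) {κ T X : ℝ} (hX : 0 < X)
    (h1 : |smoothSum r X - κ * cutoffMass * X| < T)
    (h2 : |smoothSum r (3 / 2 * X) - κ * cutoffMass * (3 / 2 * X)| < T) :
    ∃ x, X ≤ x ∧ x ≤ 2 * X ∧ |partialSum r x - κ * x| ≤ T := by
  by_contra! hcon
  have hT : 0 < T := (abs_nonneg _).trans_lt h1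
  have h3 : ∃ p, X ≤ p ∧ p ≤ 4 / 3 * X ∧ T < partialSum r p - κ * p := by
    by_contra! h
    refine absurd (smoothSum_sub_le r κ (-T) hX fun t ht ht' => ?_) (by linarith [(abs_lt.1 h1).1])
    rcases lt_abs.1 (hcon t ht (by linarith)) with h5 | h5
    · linarith [h t ht ht']
    · linarith
  have h4 : ∃ q, 3 / 2 * X ≤ q ∧ q ≤ 2 * X ∧ partialSum r q - κ * q < - T := by
    by_contra! h
    refine absurd (le_smoothSum_sub r κ T (X := 3 / 2 * X) (by linarith) fun t ht ht' => ?_)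
      (by linarith [(abs_lt.1 h2).2])
    rcases lt_abs.1 (hcon t (by linarith) (by linarith)) with h5 | h5
    · linarith
    · linarith [h t ht (by linarith)]
  obtain ⟨p, hp1, hp2, hp3⟩ := h3
  obtain ⟨q, hq1, hq2, hq3⟩ := h4
  obtain ⟨z, hz1, hz2, hz3⟩ := exists_partialSum_eq hr (p := p) (q := q) (κ := κ)
    (by linarith) (by linarith) (by linarith)
  have := hcon z (by linarith) (by linarith)
  rw [hz3, abs_zero] at this
  linarith

lemma abs_smoothSum_sub_le (r : ℕ → ℝ) (κ T : ℝ) {X : ℝ} (hX : 0 < X)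
    (h : ∀ t, X ≤ t → t ≤ 4 / 3 * X → |partialSum r t - κ * t| ≤ T) :
    |smoothSum r X - κ * cutoffMass * X| ≤ T :=
  abs_le.2 ⟨le_smoothSum_sub r κ (-T) hX fun t h1 h2 => (abs_le.1 (h t h1 h2)).1,
    smoothSum_sub_le r κ T hX fun t h1 h2 => (abs_le.1 (h t h1 h2)).2⟩

lemma tendsto_smoothSum_sub_div {r : ℕ → ℝ} {κ : ℝ}
    (hlim : Tendsto (fun x : ℝ => partialSum r x / x) atTop (nhds κ)) :
    Tendsto (fun X : ℝ => (smoothSum r X - κ * cutoffMass * X) / X) atTop (nhds 0) := by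
  rw [Metric.tendsto_atTop] at hlim ⊢
  intro δ hδ
  obtain ⟨N, hN⟩ := hlim (δ / 2) (by positivity)
  refine ⟨max N 1, fun X hX => ?_⟩
  have hX0 : 0 < X := by linarith [le_of_max_le_right hX]
  have := abs_smoothSum_sub_le r κ (δ / 2 * (4 / 3 * X)) hX0 fun t h1 h2 => by
    have h3 := hN t ((le_of_max_le_left hX).trans h1)
    have ht : 0 < t := hX0.trans_le h1
    rw [Real.dist_eq, div_sub' ht.ne', abs_div, abs_of_pos ht, div_lt_iff₀ ht,
      mul_comm t κ] at h3
    exact h3.le.trans (by gcongr)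
  rw [Real.dist_eq, sub_zero, abs_div, abs_of_pos hX0, div_lt_iff₀ hX0]
  nlinarith [mul_pos hδ hX0]

/-- A function of size `o(X)` that scales linearly under `X ↦ N * X` up to an error `O(X ^ α)`
is itself `O(X ^ α)`, provided `α < 1`. -/
lemma abs_le_of_abs_mul_sub_le {G : ℝ → ℝ} {N C α : ℝ} (hN : 1 < N) (hC : 0 ≤ C)
    (hα : 1 + N ^ α ≤ N)
    (h : ∀ X, 1 ≤ X → |N * G X - G (N * X)| ≤ C * X ^ α)
    (hlim : Tendsto (fun X => G X / X) atTop (nhds 0)) {X : ℝ} (hX : 1 ≤ X) :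
    |G X| ≤ C * X ^ α := by
  have hN0 : 0 < N := by linarith
  have key : ∀ k : ℕ, ∀ X, 1 ≤ X → |G X| ≤ C * X ^ α + |G (N ^ k * X)| / N ^ k := by
    intro k
    induction k with
    | zero =>
      intro X hX
      simp only [pow_zero, one_mul, div_one, le_add_iff_nonneg_left]
      positivity
    | succ k ih =>
      intro X hX
      have h1 := ih (N * X) (by nlinarith)
      have h2 : N * |G X| ≤ C * X ^ α + |G (N * X)| := by
        have := h X hX
        rw [← abs_of_pos hN0, ← abs_mul, abs_of_pos hN0]
        linarith [abs_sub_abs_le_abs_sub (N * G X) (G (N * X))]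
      rw [Real.mul_rpow hN0.le (by linarith), ← mul_assoc (N ^ k), ← pow_succ] at h1
      have h3 : 0 ≤ C * X ^ α := by positivity
      have h4 : N * |G X| ≤ N * (C * X ^ α + |G (N ^ (k + 1) * X)| / N ^ (k + 1)) := by
        calc N * |G X| ≤ C * X ^ α * (1 + N ^ α) + |G (N ^ (k + 1) * X)| / N ^ k := by linarith
          _ ≤ C * X ^ α * N + |G (N ^ (k + 1) * X)| / N ^ k := by gcongr
          _ = _ := by rw [pow_succ N k]; field_simp
      exact le_of_mul_le_mul_left h4 hN0
  have h1 : Tendsto (fun k : ℕ => N ^ k * X) atTop atTop :=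
    (tendsto_pow_atTop_atTop_of_one_lt hN).atTop_mul_const (by linarith)
  have h2 : Tendsto (fun k : ℕ => C * X ^ α + |G (N ^ k * X) / (N ^ k * X)| * X) atTop
      (nhds (C * X ^ α + |0| * X)) :=
    tendsto_const_nhds.add ((hlim.comp h1).abs.mul_const X)
  rw [abs_zero, zero_mul, add_zero] at h2
  refine ge_of_tendsto' h2 fun k => (key k X hX).trans_eq ?_
  rw [abs_div, abs_of_pos (by positivity : 0 < N ^ k * X)]
  field_simp

lemma abs_le_of_abs_sub_half_le {D : ℝ → ℝ} {B C α : ℝ} (hB : 0 ≤ B) (hC : 0 ≤ C)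
    (hα : 1 / 2 ≤ α) (hα' : α ≤ 1) (hD : ∀ X, 1 / 2 ≤ X → X ≤ 1 → |D X| ≤ B)
    (h : ∀ X, 1 ≤ X → |D X - D (X / 2)| ≤ C * X ^ α) {X : ℝ} (hX : 1 / 2 ≤ X) :
    |D X| ≤ (2 * B + 4 * C) * X ^ α := by
  have hhalf : (1 / 2 : ℝ) ^ α ≤ 3 / 4 := by
    calc (1 / 2 : ℝ) ^ α ≤ (1 / 2) ^ (1 / 2 : ℝ) :=
          Real.rpow_le_rpow_of_exponent_ge (by norm_num) (by norm_num) hα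
      _ ≤ 3 / 4 := by
        rw [← Real.sqrt_eq_rpow, Real.sqrt_le_left (by norm_num)]
        norm_num
  have hle : ∀ X, 1 / 2 ≤ X → X ≤ 1 → |D X| ≤ (2 * B + 4 * C) * X ^ α := by
    intro X h1 h2
    have h3 : X ≤ X ^ α := by
      simpa using Real.rpow_le_rpow_of_exponent_ge (by linarith) h2 hα'
    nlinarith [hD X h1 h2]
  have key : ∀ k : ℕ, ∀ X, 1 / 2 ≤ X → X ≤ 2 ^ k → |D X| ≤ (2 * B + 4 * C) * X ^ α := by
    intro k
    induction k with
    | zero => exact fun X h1 h2 => hle X h1 (by simpa using h2)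
    | succ k ih =>
      intro X h1 h2
      rcases le_total X 1 with h3 | h3
      · exact hle X h1 h3
      · have h4 := ih (X / 2) (by linarith) (by rw [pow_succ] at h2; linarith)
        have h5 := h X h3
        rw [div_eq_mul_one_div X 2, Real.mul_rpow (by linarith) (by norm_num)] at h4
        rw [div_eq_mul_one_div X 2] at h5
        have h6 : 0 ≤ X ^ α := Real.rpow_nonneg (by linarith) _
        have h7 : (2 * B + 4 * C) * (X ^ α * (1 / 2) ^ α) ≤ (2 * B + 4 * C) * (X ^ α * (3 / 4)) := by
          gcongr
        have h8 := abs_sub_abs_le_abs_sub (D X) (D (X * (1 / 2)))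
        nlinarith [mul_nonneg hB h6]
  obtain ⟨k, hk⟩ := pow_unbounded_of_one_lt X (one_lt_two)
  exact key k X hX hk.le

theorem exists_abs_partialSum_sub_le_rpow {r : ℕ → ℝ} (hr : ∀ m, 0 ≤ r m) {κ : ℝ}
    (hlim : Tendsto (fun x : ℝ => partialSum r x / x) atTop (nhds κ)) {N C α : ℝ} (hN : 1 < N)
    (hα : 1 / 2 ≤ α) (hα' : α ≤ 1) (hNα : 1 + N ^ α ≤ N)
    (h : ∀ X, 1 ≤ X → |N * (smoothSum r X - smoothSum r (X / 2)) -
      (smoothSum r (N * X) - smoothSum r (N * X / 2))| ≤ C * X ^ α) :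
    ∃ B > 0, ∀ X, 1 ≤ X → ∃ x, X ≤ x ∧ x ≤ 2 * X ∧ |partialSum r x - κ * x| ≤ B * x ^ α := by
  have hC : 0 ≤ C := by
    have := (abs_nonneg _).trans (h 1 le_rfl)
    rwa [Real.one_rpow, mul_one] at this
  set D : ℝ → ℝ := fun X => smoothSum r X - κ * cutoffMass * X with hD
  have hDlim : Tendsto (fun X => D X / X) atTop (nhds 0) := tendsto_smoothSum_sub_div hlim
  have hG : ∀ X, 1 ≤ X → |D X - D (X / 2)| ≤ C * X ^ α := by
    intro X hX
    refine abs_le_of_abs_mul_sub_le (G := fun X => D X - D (X / 2)) hN hC hNα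
      (fun X hX => ?_) ?_ hX
    · refine le_trans (le_of_eq (congrArg _ ?_)) (h X hX)
      simp only [hD]
      ring
    · have h1 : Tendsto (fun X : ℝ => X / 2) atTop atTop := tendsto_id.atTop_div_const two_pos
      have h2 := hDlim.sub ((hDlim.comp h1).mul_const (1 / 2))
      rw [zero_mul, sub_zero] at h2
      refine h2.congr' ?_
      filter_upwards [eventually_gt_atTop 0] with X hX
      simp only [Function.comp_apply]
      field_simp
  set B₀ : ℝ := partialSum r 2 + |κ| * 2 with hB₀
  have hpos : ∀ x, 0 ≤ partialSum r x := fun x => Finset.sum_nonneg fun m _ => hr m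
  have hsmall : ∀ X, 1 / 2 ≤ X → X ≤ 1 → |D X| ≤ B₀ := by
    intro X h1 h2
    refine abs_smoothSum_sub_le r κ B₀ (by linarith) fun t h3 h4 => ?_
    refine (abs_sub _ _).trans ?_
    rw [abs_of_nonneg (hpos _), abs_mul, abs_of_nonneg (by linarith : 0 ≤ t)]
    have h5 : partialSum r t ≤ partialSum r 2 := Finset.sum_le_sum_of_subset_of_nonneg
      (Finset.Icc_subset_Icc_right (Nat.floor_le_floor (by linarith))) fun m _ _ => hr m
    have h6 : |κ| * t ≤ |κ| * 2 := by gcongr; linarith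
    linarith
  have hB₀0 : 0 ≤ B₀ := by have := hpos 2; positivity
  have hDX := fun X hX => abs_le_of_abs_sub_half_le hB₀0 hC hα hα' hsmall hG (X := X) hX
  set E := 2 * B₀ + 4 * C with hE
  have hE0 : 0 ≤ E := by positivity
  refine ⟨2 * E + 1, by positivity, fun X hX => ?_⟩
  have hXα : 1 ≤ X ^ α := Real.one_le_rpow hX (by linarith)
  have h32 : (3 / 2 * X) ^ α ≤ 3 / 2 * X ^ α := by
    rw [Real.mul_rpow (by norm_num) (by linarith)]
    gcongr
    exact (Real.rpow_le_rpow_of_exponent_le (by norm_num) hα').trans_eq (Real.rpow_one _)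
  obtain ⟨x, hx1, hx2, hx3⟩ := exists_abs_partialSum_sub_le hr (κ := κ)
    (T := (2 * E + 1) * X ^ α) (X := X) (by linarith)
    ((hDX X (by linarith)).trans_lt (by nlinarith))
    ((hDX (3 / 2 * X) (by linarith)).trans_lt (by nlinarith))
  refine ⟨x, hx1, hx2, hx3.trans ?_⟩
  gcongr

lemma hasFDerivAt_fwdDiff_iter {E G : Type*} [NormedAddCommGroup E] [NormedSpace ℝ E]
    [NormedAddCommGroup G] [NormedSpace ℝ G] {F : E → G} {F' : E → E →L[ℝ] G}
    (hF : ∀ x, HasFDerivAt F (F' x) x) (v : E) (k : ℕ) (x : E) :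
    HasFDerivAt ((fwdDiff v)^[k] F) ((fwdDiff v)^[k] F' x) x := by
  induction k generalizing x with
  | zero => exact hF x
  | succ k ih =>
    rw [Function.iterate_succ_apply', Function.iterate_succ_apply']
    exact ((hasFDerivAt_comp_add_right v).2 (ih (x + v))).sub (ih x)

lemma norm_fwdDiff_iter_succ_le {E G : Type*} [NormedAddCommGroup E] [NormedSpace ℝ E]
    [NormedAddCommGroup G] [NormedSpace ℝ G] {F : E → G} (hF : Differentiable ℝ F) {k : ℕ}
    {C : ℝ} (hC : ∀ v x, ‖(fwdDiff v)^[k] (fderiv ℝ F) x‖ ≤ C * ‖v‖ ^ k) (v x : E) :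
    ‖(fwdDiff v)^[k + 1] F x‖ ≤ C * ‖v‖ ^ (k + 1) := by
  rw [Function.iterate_succ_apply', fwdDiff]
  have hd := hasFDerivAt_fwdDiff_iter (fun x => (hF x).hasFDerivAt) v k
  have := convex_univ.norm_image_sub_le_of_norm_hasFDerivWithin_le
    (f := (fwdDiff v)^[k] F) (fun x _ => (hd x).hasFDerivWithinAt) (fun x _ => hC v x)
    (mem_univ x) (mem_univ (x + v))
  rwa [add_sub_cancel_left, mul_assoc, ← pow_succ] at this

set_option maxSynthPendingDepth 5 in
lemma exists_abs_fwdDiff_three_le {E : Type*} [NormedAddCommGroup E] [NormedSpace ℝ E]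
    {F : E → ℝ} (hF : ContDiff ℝ 3 F) (hs : HasCompactSupport F) :
    ∃ C, 0 ≤ C ∧ ∀ v x, |(fwdDiff v)^[3] F x| ≤ C * ‖v‖ ^ 3 := by
  have h1 : ContDiff ℝ 2 (fderiv ℝ F) := hF.fderiv_right (by norm_num)
  have h2 : ContDiff ℝ 1 (fderiv ℝ (fderiv ℝ F)) := h1.fderiv_right (by norm_num)
  have h3 : ContDiff ℝ 0 (fderiv ℝ (fderiv ℝ (fderiv ℝ F))) := h2.fderiv_right (by norm_num)
  obtain ⟨C, hC⟩ := h3.continuous.bounded_above_of_compact_support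
    (((hs.fderiv ℝ).fderiv ℝ).fderiv ℝ)
  refine ⟨C, (norm_nonneg _).trans (hC 0), fun v x =>
    norm_fwdDiff_iter_succ_le (hF.differentiable (by norm_num)) ?_ v x⟩
  refine norm_fwdDiff_iter_succ_le (h1.differentiable (by norm_num)) ?_
  refine norm_fwdDiff_iter_succ_le (h2.differentiable (by norm_num)) ?_
  intro v x
  simpa using hC x

/-- The sum of `F` over the lattice `h ℤ^ι`. -/
noncomputable def latticeSum {ι : Type*} (F : (ι → ℝ) → ℝ) (h : ℝ) : ℝ :=
  ∑' k : ι → ℤ, F (h • fun i => (k i : ℝ))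

section LatticeSum

variable {ι : Type*} [Fintype ι]

/-- The integer points in a box containing all lattice points at which `F` can be nonzero. -/
noncomputable def integerBox (ι : Type*) [Fintype ι] (B : ℝ) : Finset (ι → ℤ) :=
  open scoped Classical in Fintype.piFinset fun _ : ι => Finset.Icc (-⌊B⌋) ⌊B⌋

lemma mem_integerBox {B h : ℝ} (hh : 0 < h) {k : ι → ℤ}
    (hk : ‖h • fun i => (k i : ℝ)‖ ≤ B) : k ∈ integerBox ι (B / h) := by
  classical
  rw [integerBox, Fintype.mem_piFinset]
  intro i
  have h1 := (norm_le_pi_norm (h • fun i => (k i : ℝ)) i).trans hk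
  rw [Pi.smul_apply, norm_smul, Real.norm_eq_abs, Real.norm_eq_abs, abs_of_pos hh,
    mul_comm, ← le_div_iff₀ hh, abs_le] at h1
  rw [Finset.mem_Icc]
  refine ⟨?_, Int.le_floor.2 h1.2⟩
  rw [neg_le]
  exact Int.le_floor.2 (by push_cast; linarith)

lemma card_integerBox_le {B h : ℝ} (hB : 0 ≤ B) (hh : 0 < h) (hh1 : h ≤ 1) :
    ((integerBox ι (B / h)).card : ℝ) ≤ (2 * B + 1) ^ Fintype.card ι / h ^ Fintype.card ι := by
  classical
  rw [integerBox, Fintype.card_piFinset, Finset.prod_const, Finset.card_univ, Nat.cast_pow,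
    ← div_pow]
  gcongr
  have h0 : 0 ≤ B / h := by positivity
  have h1 : (0 : ℤ) ≤ ⌊B / h⌋ := Int.floor_nonneg.2 h0
  have h2 : ((Finset.Icc (-⌊B / h⌋) ⌊B / h⌋).card : ℝ) = 2 * ⌊B / h⌋ + 1 := by
    rw [Int.card_Icc, ← Int.cast_natCast, Int.toNat_of_nonneg (by linarith)]
    push_cast
    ring
  rw [h2, add_div, mul_div_assoc]
  have h3 : 1 ≤ 1 / h := by rwa [le_div_iff₀ hh, one_mul]
  linarith [Int.floor_le (B / h)]

lemma summable_lattice {F : (ι → ℝ) → ℝ} {R : ℝ} (hR : ∀ x, F x ≠ 0 → ‖x‖ ≤ R) {h : ℝ}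
    (hh : 0 < h) (w : ι → ℝ) :
    Summable fun k : ι → ℤ => F ((h • fun i => (k i : ℝ)) + w) := by
  refine summable_of_hasFiniteSupport ((integerBox ι ((R + ‖w‖) / h)).finite_toSet.subset ?_)
  intro k hk
  refine mem_integerBox hh ?_
  have := norm_sub_le ((h • fun i => (k i : ℝ)) + w) w
  rw [add_sub_cancel_right] at this
  linarith [hR _ hk]

lemma abs_latticeSum_sub_shift_le {F : (ι → ℝ) → ℝ} {R C : ℝ} (hR0 : 0 ≤ R)
    (hR : ∀ x, F x ≠ 0 → ‖x‖ ≤ R) (hC0 : 0 ≤ C)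
    (hC : ∀ v x, |(fwdDiff v)^[3] F x| ≤ C * ‖v‖ ^ 3) {h : ℝ} (hh : 0 < h) (hh1 : h ≤ 1)
    (e : ι → ℤ) (he : ‖fun i => (e i : ℝ)‖ ≤ 1) :
    |latticeSum F h - ∑' k : ι → ℤ, F ((h • fun i => (k i : ℝ)) + (h / 2) • fun i => (e i : ℝ))| ≤
      C * (2 * (R + 2) + 1) ^ Fintype.card ι * h ^ 3 / h ^ Fintype.card ι := by
  set v : ι → ℝ := (h / 2) • fun i => (e i : ℝ) with hv
  set T : (ι → ℝ) → ℝ := fun w => ∑' k : ι → ℤ, F ((h • fun i => (k i : ℝ)) + w) with hT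
  have hvh : ‖v‖ ≤ h / 2 := by
    rw [hv, norm_smul, Real.norm_eq_abs, abs_of_pos (by positivity)]
    exact mul_le_of_le_one_right (by positivity) he
  have hper : ∀ w, T (w + (2 : ℕ) • v) = T w := by
    intro w
    simp only [hT]
    rw [← (Equiv.addRight e).tsum_eq fun k : ι → ℤ => F ((h • fun i => (k i : ℝ)) + w)]
    refine (tsum_congr fun k => congrArg F ?_).symm
    ext i
    simp only [hv, two_nsmul, Equiv.coe_addRight, Pi.add_apply, Pi.smul_apply, smul_eq_mul,
      Int.cast_add]
    ring
  have h0 : latticeSum F h = T 0 := by simp [hT, latticeSum]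
  have hsum := summable_lattice hR hh
  have hdiff : ∑' k : ι → ℤ, (fwdDiff v)^[3] F (h • fun i => (k i : ℝ)) = 4 * (T v - T 0) := by
    have hexp : ∀ x, (fwdDiff v)^[3] F x =
        F (x + (v + (2 : ℕ) • v)) - 3 * F (x + (0 + (2 : ℕ) • v)) + 3 * F (x + v) - F (x + 0) := by
      intro x
      have h1 : x + v + v + v = x + (v + (2 : ℕ) • v) := by rw [two_nsmul]; abel
      have h2 : x + v + v = x + (0 + (2 : ℕ) • v) := by rw [two_nsmul]; abel
      simp only [Function.iterate_succ, Function.iterate_zero, Function.comp_apply, id_eq,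
        fwdDiff, add_zero]
      rw [h1, h2]
      ring
    simp only [hexp]
    rw [Summable.tsum_sub, Summable.tsum_add, Summable.tsum_sub, tsum_mul_left, tsum_mul_left]
    · change T _ - 3 * T _ + 3 * T _ - T _ = _
      rw [hper, hper]
      ring
    · exact hsum _
    · exact (hsum _).mul_left 3
    · exact (hsum _).sub ((hsum _).mul_left 3)
    · exact (hsum _).mul_left 3
    · exact ((hsum _).sub ((hsum _).mul_left 3)).add ((hsum _).mul_left 3)
    · exact hsum _
  have hsupp : ∀ k ∉ integerBox ι ((R + 2) / h),
      (fwdDiff v)^[3] F (h • fun i => (k i : ℝ)) = 0 := by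
    intro k hk
    have hbig : R + 2 < ‖h • fun i => (k i : ℝ)‖ := by
      by_contra! hcon
      exact hk (mem_integerBox hh hcon)
    have hzero : ∀ w, ‖w‖ ≤ 2 → F ((h • fun i => (k i : ℝ)) + w) = 0 := by
      intro w hw
      by_contra hne
      have h1 := norm_sub_le ((h • fun i => (k i : ℝ)) + w) w
      rw [add_sub_cancel_right] at h1
      linarith [hR _ hne]
    have n2 : ‖v + v‖ ≤ 2 := (norm_add_le _ _).trans (by linarith)
    have n3 : ‖v + v + v‖ ≤ 2 := (norm_add₃_le).trans (by linarith)
    simp only [Function.iterate_succ, Function.iterate_zero, Function.comp_apply, id_eq, fwdDiff]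
    have e0 := hzero 0 (by simp)
    have e1 := hzero v (by linarith)
    have e2 := hzero _ n2
    have e3 := hzero _ n3
    simp only [← add_assoc, add_zero] at e0 e1 e2 e3
    rw [e0, e1, e2, e3]
    ring
  have hbound : |4 * (T v - T 0)| ≤ (integerBox ι ((R + 2) / h)).card * (C * ‖v‖ ^ 3) := by
    rw [← hdiff, tsum_eq_sum hsupp, ← nsmul_eq_mul]
    exact (Finset.abs_sum_le_sum_abs _ _).trans (Finset.sum_le_card_nsmul _ _ _ fun k _ => hC _ _)
  have hC' : C * ‖v‖ ^ 3 ≤ C * h ^ 3 := by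
    gcongr
    linarith
  have hcard := card_integerBox_le (ι := ι) (B := R + 2) (by linarith) hh hh1
  have h1 : 4 * |T 0 - T v| ≤ (2 * (R + 2) + 1) ^ Fintype.card ι / h ^ Fintype.card ι *
      (C * h ^ 3) := by
    rw [abs_sub_comm, ← abs_of_pos (four_pos (α := ℝ)), ← abs_mul]
    refine hbound.trans ?_
    gcongr
  rw [h0]
  change |T 0 - T v| ≤ _
  have h2 : C * (2 * (R + 2) + 1) ^ Fintype.card ι * h ^ 3 / h ^ Fintype.card ι =
    (2 * (R + 2) + 1) ^ Fintype.card ι / h ^ Fintype.card ι * (C * h ^ 3) := by ring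
  rw [h2]
  linarith [abs_nonneg (T 0 - T v)]

lemma latticeSum_half_eq [DecidableEq ι] {F : (ι → ℝ) → ℝ} {R : ℝ}
    (hR : ∀ x, F x ≠ 0 → ‖x‖ ≤ R) {h : ℝ} (hh : 0 < h) :
    latticeSum F (h / 2) = ∑ e : ι → Fin 2, ∑' k : ι → ℤ,
      F ((h • fun i => (k i : ℝ)) + (h / 2) • fun i => (((e i : ℕ) : ℤ) : ℝ)) := by
  let φ : (ι → ℤ) ≃ (ι → Fin 2) × (ι → ℤ) :=
    ((Equiv.piCongrRight fun _ => Int.divModEquiv 2).trans (Equiv.arrowProdEquivProdArrow _ _ _)).trans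
      (Equiv.prodComm _ _)
  have hφ : ∀ e k, F ((h / 2) • fun i => ((φ.symm (e, k) i : ℤ) : ℝ)) =
      F ((h • fun i => (k i : ℝ)) + (h / 2) • fun i => (((e i : ℕ) : ℤ) : ℝ)) := by
    intro e k
    congr 1
    ext i
    simp [φ, Int.divModEquiv]
    ring
  rw [latticeSum, ← φ.symm.tsum_eq, Summable.tsum_prod, tsum_fintype]
  · exact Finset.sum_congr rfl fun e _ => tsum_congr fun k => hφ e k
  · refine (φ.symm.summable_iff (f := fun k : ι → ℤ => F ((h / 2) • fun i => (k i : ℝ)))).2 ?_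
    simpa using summable_lattice hR (half_pos hh) 0

theorem exists_abs_latticeSum_sub_le {F : (ι → ℝ) → ℝ} (hF : ContDiff ℝ 3 F)
    (hs : HasCompactSupport F) :
    ∃ C, ∀ h, 0 < h → h ≤ 1 →
      |2 ^ Fintype.card ι * latticeSum F h - latticeSum F (h / 2)| ≤
        C * (h ^ 3 / h ^ Fintype.card ι) := by
  classical
  obtain ⟨C, hC0, hC⟩ := exists_abs_fwdDiff_three_le hF hs
  obtain ⟨R, hR0, hR⟩ := hs.isBounded.exists_pos_norm_le
  replace hR : ∀ x, F x ≠ 0 → ‖x‖ ≤ R := fun x hx => hR x (subset_tsupport _ hx)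
  refine ⟨2 ^ Fintype.card ι * (C * (2 * (R + 2) + 1) ^ Fintype.card ι), fun h hh hh1 => ?_⟩
  have h1 : (2 : ℝ) ^ Fintype.card ι = ((Finset.univ : Finset (ι → Fin 2)).card : ℝ) := by simp
  rw [latticeSum_half_eq hR hh, h1, ← nsmul_eq_mul, ← Finset.sum_const, ← Finset.sum_sub_distrib]
  refine (Finset.abs_sum_le_sum_abs _ _).trans ?_
  refine (Finset.sum_le_card_nsmul _ _ _ fun e _ =>
    abs_latticeSum_sub_shift_le hR0.le hR hC0 hC hh hh1 (fun i => (e i : ℕ)) ?_).trans_eq ?_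
  · refine (pi_norm_le_iff_of_nonneg zero_le_one).2 fun i => ?_
    have : (e i : ℕ) ≤ 1 := Nat.lt_succ_iff.1 (e i).2
    simpa using this
  · rw [nsmul_eq_mul]
    ring

end LatticeSum

/-- A smooth bump supported in `[0, 2]` whose integer translates sum to `1`. -/
noncomputable def unitBump (t : ℝ) : ℝ := Real.smoothTransition t - Real.smoothTransition (t - 1)

theorem contDiff_unitBump {n : ℕ∞} : ContDiff ℝ n unitBump :=
  Real.smoothTransition.contDiff.sub
    (Real.smoothTransition.contDiff.comp (contDiff_id.sub contDiff_const))

theorem unitBump_of_nonpos {t : ℝ} (ht : t ≤ 0) : unitBump t = 0 := by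
  rw [unitBump, Real.smoothTransition.zero_of_nonpos ht,
    Real.smoothTransition.zero_of_nonpos (by linarith), sub_zero]

theorem unitBump_of_two_le {t : ℝ} (ht : 2 ≤ t) : unitBump t = 0 := by
  rw [unitBump, Real.smoothTransition.one_of_one_le (by linarith),
    Real.smoothTransition.one_of_one_le (by linarith), sub_self]

theorem unitBump_add_intCast_eq_zero {c : ℝ} {k : ℤ} (hk : k ∉ Finset.Icc (-⌊c⌋) (1 - ⌊c⌋)) :
    unitBump (c + k) = 0 := by
  have h1 := Int.floor_le c
  have h2 := Int.lt_floor_add_one c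
  rw [Finset.mem_Icc, not_and_or, not_le, not_le] at hk
  rcases hk with hk | hk
  · refine unitBump_of_nonpos ?_
    have : (k : ℝ) + 1 ≤ -⌊c⌋ := by exact_mod_cast hk
    linarith
  · refine unitBump_of_two_le ?_
    have : (1 : ℝ) - ⌊c⌋ + 1 ≤ k := by exact_mod_cast hk
    linarith

theorem sum_unitBump_add_intCast (c : ℝ) :
    ∑ k ∈ Finset.Icc (-⌊c⌋) (1 - ⌊c⌋), unitBump (c + k) = 1 := by
  have h1 := Int.floor_le c
  have h2 := Int.lt_floor_add_one c
  have : Finset.Icc (-⌊c⌋) (1 - ⌊c⌋) = {-⌊c⌋, 1 - ⌊c⌋} := by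
    ext k
    simp only [Finset.mem_Icc, Finset.mem_insert, Finset.mem_singleton]
    omega
  rw [this, Finset.sum_pair (by omega)]
  push_cast
  rw [unitBump, unitBump, Real.smoothTransition.zero_of_nonpos (by linarith : c + -⌊c⌋ - 1 ≤ 0),
    Real.smoothTransition.one_of_one_le (by linarith : 1 ≤ c + (1 - (⌊c⌋ : ℝ))),
    show c + (1 - (⌊c⌋ : ℝ)) - 1 = c + -⌊c⌋ by ring]
  ring

theorem hasSum_prod_unitBump {ι : Type*} [Fintype ι] (c : ι → ℝ) :
    HasSum (fun e : ι → ℤ => ∏ i, unitBump (c i + e i)) 1 := by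
  classical
  have h : ∏ i, ∑ k ∈ Finset.Icc (-⌊c i⌋) (1 - ⌊c i⌋), unitBump (c i + k) = 1 :=
    Finset.prod_eq_one fun i _ => sum_unitBump_add_intCast (c i)
  rw [Finset.prod_univ_sum] at h
  rw [← h]
  refine hasSum_sum_of_ne_finset_zero fun e he => ?_
  rw [Fintype.mem_piFinset, not_forall] at he
  obtain ⟨i, hi⟩ := he
  exact Finset.prod_eq_zero (Finset.mem_univ i) (unitBump_add_intCast_eq_zero hi)

/-- A smooth dyadic weight supported in `[1/2, 4/3]`. -/
noncomputable def dyadicWeight (y : ℝ) : ℝ := cutoff y - cutoff (2 * y)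

theorem contDiff_dyadicWeight {n : ℕ∞} : ContDiff ℝ n dyadicWeight :=
  contDiff_cutoff.sub (contDiff_cutoff.comp (contDiff_const.mul contDiff_id))

theorem dyadicWeight_of_le {y : ℝ} (hy : y ≤ 1 / 2) : dyadicWeight y = 0 := by
  rw [dyadicWeight, cutoff_of_le_one (by linarith), cutoff_of_le_one (by linarith), sub_self]

theorem dyadicWeight_of_ge {y : ℝ} (hy : 4 / 3 ≤ y) : dyadicWeight y = 0 := by
  rw [dyadicWeight, cutoff_of_four_thirds_le hy, cutoff_of_four_thirds_le (by linarith), sub_self]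

section Cone

open NumberField.InfinitePlace NumberField.mixedEmbedding NumberField.Units
  NumberField.Units.dirichletUnitTheorem Module

open scoped Classical

variable {K : Type*} [Field K] [NumberField K]

theorem contDiffAt_normAtPlace {m : WithTop ℕ∞} {x : mixedSpace K} {w : InfinitePlace K}
    (hx : normAtPlace w x ≠ 0) : ContDiffAt ℝ m (fun y : mixedSpace K => normAtPlace w y) x := by
  by_cases hw : IsReal w
  · have h : (fun y : mixedSpace K => normAtPlace w y) = fun y => ‖y.1 ⟨w, hw⟩‖ :=
      funext fun y => normAtPlace_apply_of_isReal hw y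
    rw [normAtPlace_apply_of_isReal hw] at hx
    rw [h]
    refine ContDiffAt.norm ℝ ?_ (norm_ne_zero_iff.mp hx)
    have : ContDiff ℝ m fun y : mixedSpace K => y.1 ⟨w, hw⟩ :=
      (contDiff_apply ℝ ℝ _).comp contDiff_fst
    exact this.contDiffAt
  · have hw := not_isReal_iff_isComplex.mp hw
    have h : (fun y : mixedSpace K => normAtPlace w y) = fun y => ‖y.2 ⟨w, hw⟩‖ :=
      funext fun y => normAtPlace_apply_of_isComplex hw y
    rw [normAtPlace_apply_of_isComplex hw] at hx
    rw [h]
    refine ContDiffAt.norm ℝ ?_ (norm_ne_zero_iff.mp hx)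
    have : ContDiff ℝ m fun y : mixedSpace K => y.2 ⟨w, hw⟩ :=
      (contDiff_apply ℝ ℂ _).comp contDiff_snd
    exact this.contDiffAt

theorem contDiffAt_mixedEmbedding_norm {m : WithTop ℕ∞} {x : mixedSpace K}
    (hx : mixedEmbedding.norm x ≠ 0) :
    ContDiffAt ℝ m (fun y : mixedSpace K => mixedEmbedding.norm y) x := by
  simp_rw [mixedEmbedding.norm_apply]
  exact contDiffAt_prod fun w _ =>
    (contDiffAt_normAtPlace (mixedEmbedding.norm_ne_zero_iff.mp hx w)).pow _

theorem contDiffAt_logMap {m : WithTop ℕ∞} {x : mixedSpace K} (hx : mixedEmbedding.norm x ≠ 0) :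
    ContDiffAt ℝ m (logMap (K := K)) x := by
  rw [contDiffAt_pi]
  intro w
  simp_rw [logMap_apply]
  exact contDiffAt_const.mul
    (((contDiffAt_normAtPlace (mixedEmbedding.norm_ne_zero_iff.mp hx w)).log
      (mixedEmbedding.norm_ne_zero_iff.mp hx w)).sub
      (((contDiffAt_mixedEmbedding_norm hx).log hx).mul contDiffAt_const))

/-- The coordinates of the logarithmic map with respect to the fundamental units. -/
noncomputable def unitCoord (x : mixedSpace K) : Fin (rank K) → ℝ :=
  ((basisUnitLattice K).ofZLatticeBasis ℝ (unitLattice K)).equivFun (logMap x)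

theorem contDiffAt_unitCoord {m : WithTop ℕ∞} {x : mixedSpace K}
    (hx : mixedEmbedding.norm x ≠ 0) (i : Fin (rank K)) :
    ContDiffAt ℝ m (fun y : mixedSpace K => unitCoord y i) x := by
  have h : ContDiff ℝ m fun v : logSpace K =>
      ((basisUnitLattice K).ofZLatticeBasis ℝ (unitLattice K)).equivFun v i :=
    ((LinearMap.proj i).comp ((basisUnitLattice K).ofZLatticeBasis ℝ
      (unitLattice K)).equivFun.toLinearMap).toContinuousLinearMap.contDiff
  exact h.contDiffAt.comp x (contDiffAt_logMap hx)

theorem unitCoord_real_smul {x : mixedSpace K} (hx : mixedEmbedding.norm x ≠ 0) {c : ℝ}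
    (hc : c ≠ 0) : unitCoord (c • x) = unitCoord x := by
  rw [unitCoord, logMap_real_smul hx hc, unitCoord]

theorem unitCoord_unit_smul {x : mixedSpace K} (hx : mixedEmbedding.norm x ≠ 0)
    (ζ : torsion K) (e : Fin (rank K) → ℤ) (i : Fin (rank K)) :
    unitCoord (((ζ : (𝓞 K)ˣ) * ∏ j, fundSystem K j ^ e j) • x) i = unitCoord x i + e i := by
  have h : logEmbedding K (Additive.ofMul ((ζ : (𝓞 K)ˣ) * ∏ j, fundSystem K j ^ e j)) =
      ∑ j, (e j : ℝ) • (basisUnitLattice K).ofZLatticeBasis ℝ (unitLattice K) j := by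
    rw [ofMul_mul, map_add, (logEmbedding_eq_zero_iff).mpr ζ.2, zero_add, ofMul_prod, map_sum]
    refine Finset.sum_congr rfl fun j _ => ?_
    rw [ofMul_zpow, map_zsmul, logEmbedding_fundSystem, Basis.ofZLatticeBasis_apply,
      Int.cast_smul_eq_zsmul]
  rw [unitCoord, logMap_unit_smul _ hx, h, map_add, map_sum, Pi.add_apply, add_comm, unitCoord]
  congr 1
  simp [Finset.sum_apply, Finsupp.single_apply]

/-- A smooth, compactly supported weight on the mixed space, adapted to the action of units. -/
noncomputable def coneWeight (a : ℝ) (x : mixedSpace K) : ℝ :=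
  dyadicWeight (mixedEmbedding.norm x / a) * ∏ i, unitBump (unitCoord x i)

theorem coneWeight_of_norm_le {a : ℝ} (ha : 0 < a) {x : mixedSpace K}
    (hx : mixedEmbedding.norm x ≤ a / 2) : coneWeight a x = 0 := by
  rw [coneWeight, dyadicWeight_of_le, zero_mul]
  rw [div_le_iff₀ ha]
  linarith

theorem contDiff_coneWeight {a : ℝ} (ha : 0 < a) {m : ℕ∞} :
    ContDiff ℝ m (coneWeight (K := K) a) := by
  rw [contDiff_iff_contDiffAt]
  intro x
  by_cases hx : mixedEmbedding.norm x = 0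
  · refine (contDiffAt_const (c := (0 : ℝ))).congr_of_eventuallyEq ?_
    have : ∀ᶠ y in nhds x, mixedEmbedding.norm y < a / 2 := by
      refine (mixedEmbedding.continuous_norm K).tendsto x |>.eventually_lt_const ?_
      rw [hx]
      positivity
    filter_upwards [this] with y hy using coneWeight_of_norm_le ha hy.le
  · refine ContDiffAt.mul ?_ ?_
    · exact contDiff_dyadicWeight.contDiffAt.comp x
        ((contDiffAt_mixedEmbedding_norm hx).div_const a)
    · exact contDiffAt_prod fun i _ =>
        contDiff_unitBump.contDiffAt.comp x (contDiffAt_unitCoord hx i)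

theorem mult_mul_log_normAtPlace_eq {x : mixedSpace K} (w : {w : InfinitePlace K // w ≠ w₀}) :
    (mult w.1 : ℝ) * Real.log (normAtPlace w.1 x) = logMap x w +
      mult w.1 * (Real.log (mixedEmbedding.norm x) * (finrank ℚ K : ℝ)⁻¹) := by
  rw [logMap_apply]
  ring

theorem mult_mul_log_normAtPlace_w₀ {x : mixedSpace K} (hx : mixedEmbedding.norm x ≠ 0) :
    (mult (w₀ : InfinitePlace K) : ℝ) * Real.log (normAtPlace (w₀ : InfinitePlace K) x) =
      Real.log (mixedEmbedding.norm x) - ∑ w : {w : InfinitePlace K // w ≠ w₀},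
        (mult w.1 : ℝ) * Real.log (normAtPlace w.1 x) := by
  have h : Real.log (mixedEmbedding.norm x) =
      ∑ w, (mult w : ℝ) * Real.log (normAtPlace w x) := by
    rw [mixedEmbedding.norm_apply, Real.log_prod]
    · simp_rw [Real.log_pow]
    · exact fun w _ => pow_ne_zero _ (mixedEmbedding.norm_ne_zero_iff.mp hx w)
  rw [h, Fintype.sum_eq_add_sum_subtype_ne _ w₀]
  ring

theorem hasCompactSupport_coneWeight {a : ℝ} (ha : 0 < a) :
    HasCompactSupport (coneWeight (K := K) a) := by
  let b := (basisUnitLattice K).ofZLatticeBasis ℝ (unitLattice K)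
  obtain ⟨M, hM⟩ : ∃ M : ℝ, M = ∑ i, 2 * ‖b i‖ := ⟨_, rfl⟩
  obtain ⟨L, hL⟩ : ∃ L : ℝ, L = |Real.log (a / 2)| + |Real.log (2 * a)| := ⟨_, rfl⟩
  obtain ⟨R, hR⟩ : ∃ R : ℝ, R = M + 2 * L := ⟨_, rfl⟩
  obtain ⟨T, hT⟩ : ∃ T : ℝ, T = L + ∑ _w : {w : InfinitePlace K // w ≠ w₀}, R := ⟨_, rfl⟩
  have hM0 : 0 ≤ M := hM ▸ Finset.sum_nonneg fun i _ => mul_nonneg zero_le_two (norm_nonneg _)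
  have hL0 : 0 ≤ L := hL ▸ add_nonneg (abs_nonneg _) (abs_nonneg _)
  have hR0 : 0 ≤ R := hR ▸ add_nonneg hM0 (mul_nonneg zero_le_two hL0)
  refine HasCompactSupport.of_support_subset_isCompact
    (isCompact_closedBall (0 : mixedSpace K) (Real.exp (R + T))) ?_
  intro x hx
  rw [Function.mem_support] at hx
  have hx1 := left_ne_zero_of_mul hx
  have hx2 := right_ne_zero_of_mul hx
  have hlow : a / 2 < mixedEmbedding.norm x := by
    by_contra h
    exact hx (coneWeight_of_norm_le ha (not_lt.mp h))
  have hup : mixedEmbedding.norm x < 2 * a := by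
    by_contra h
    refine hx1 (dyadicWeight_of_ge ?_)
    rw [le_div_iff₀ ha]
    linarith
  have hpos : 0 < mixedEmbedding.norm x := by linarith
  have hlog : |Real.log (mixedEmbedding.norm x)| ≤ L := by
    have h1 := Real.log_le_log (by positivity) hlow.le
    have h2 := Real.log_le_log hpos hup.le
    rw [abs_le]
    constructor
    · linarith [neg_abs_le (Real.log (a / 2)), abs_nonneg (Real.log (2 * a))]
    · linarith [le_abs_self (Real.log (2 * a)), abs_nonneg (Real.log (a / 2))]
  have hcoord : ∀ i, |unitCoord x i| ≤ 2 := by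
    intro i
    have hi : unitBump (unitCoord x i) ≠ 0 := Finset.prod_ne_zero_iff.mp hx2 i (Finset.mem_univ i)
    rw [abs_le]
    constructor
    · by_contra h
      exact hi (unitBump_of_nonpos (by linarith))
    · by_contra h
      exact hi (unitBump_of_two_le (by linarith))
  have hlm : ‖logMap x‖ ≤ M := by
    rw [← b.sum_equivFun (logMap x), hM]
    refine (norm_sum_le _ _).trans (Finset.sum_le_sum fun i _ => ?_)
    rw [_root_.norm_smul]
    exact mul_le_mul_of_nonneg_right (hcoord i) (norm_nonneg _)
  have hw : ∀ w : {w : InfinitePlace K // w ≠ w₀},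
      |(mult w.1 : ℝ) * Real.log (normAtPlace w.1 x)| ≤ R := by
    intro w
    rw [mult_mul_log_normAtPlace_eq, hR]
    refine (abs_add_le _ _).trans (add_le_add ((norm_le_pi_norm (logMap x) w).trans hlm) ?_)
    have hm : (mult w.1 : ℝ) ≤ 2 := by
      unfold mult
      split_ifs <;> norm_num
    have hn : (finrank ℚ K : ℝ)⁻¹ ≤ 1 := by
      apply inv_le_one_of_one_le₀
      exact_mod_cast Nat.one_le_iff_ne_zero.mpr finrank_pos.ne'
    rw [abs_mul, abs_mul, abs_of_nonneg (Nat.cast_nonneg _ : (0 : ℝ) ≤ mult w.1),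
      abs_of_nonneg (by positivity : (0 : ℝ) ≤ (finrank ℚ K : ℝ)⁻¹)]
    refine mul_le_mul hm ?_ (by positivity) (by norm_num)
    calc _ ≤ L * 1 := by gcongr
      _ = L := mul_one L
  have hw₀ : |(mult (w₀ : InfinitePlace K) : ℝ) *
      Real.log (normAtPlace (w₀ : InfinitePlace K) x)| ≤ T := by
    rw [mult_mul_log_normAtPlace_w₀ hpos.ne', hT]
    refine (abs_sub _ _).trans (add_le_add hlog ?_)
    exact (Finset.abs_sum_le_sum_abs _ _).trans (Finset.sum_le_sum fun w _ => hw w)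
  have hT0 : 0 ≤ T := (abs_nonneg _).trans hw₀
  have hall : ∀ w : InfinitePlace K, normAtPlace w x ≤ Real.exp (R + T) := by
    intro w
    have hwpos : 0 < normAtPlace w x := lt_of_le_of_ne (normAtPlace_nonneg _ _)
      (mixedEmbedding.norm_ne_zero_iff.mp hpos.ne' w).symm
    have h : |(mult w : ℝ) * Real.log (normAtPlace w x)| ≤ R + T := by
      by_cases hww : w = w₀
      · subst hww
        linarith
      · linarith [hw ⟨w, hww⟩]
    have hm : (1 : ℝ) ≤ mult w := by exact_mod_cast one_le_mult
    rw [abs_mul, abs_of_nonneg (Nat.cast_nonneg _ : (0 : ℝ) ≤ mult w)] at h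
    rw [← Real.log_le_iff_le_exp hwpos]
    refine (le_abs_self _).trans (le_trans ?_ h)
    exact le_mul_of_one_le_left (abs_nonneg _) hm
  rw [mem_closedBall_zero_iff, norm_eq_sup'_normAtPlace]
  exact Finset.sup'_le _ _ fun w _ => hall w

theorem coneWeight_real_smul {a : ℝ} {h : ℝ} (hh : 0 < h) {x : mixedSpace K}
    (hx : mixedEmbedding.norm x ≠ 0) :
    coneWeight a (h • x) =
      dyadicWeight (h ^ finrank ℚ K * mixedEmbedding.norm x / a) *
        ∏ i, unitBump (unitCoord x i) := by
  rw [coneWeight, unitCoord_real_smul hx hh.ne', mixedEmbedding.norm_smul, abs_of_pos hh]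

end Cone

section Unfolding

open NumberField.InfinitePlace NumberField.mixedEmbedding NumberField.Units
  NumberField.Units.dirichletUnitTheorem Module nonZeroDivisors

variable {K : Type*} [Field K] [NumberField K]

variable (K) in
/-- Units as pairs consisting of a root of unity and exponents of fundamental units. -/
noncomputable def unitOfExponents (p : torsion K × (Fin (rank K) → ℤ)) : (𝓞 K)ˣ :=
  (p.1 : (𝓞 K)ˣ) * ∏ j, fundSystem K j ^ p.2 j

variable (K) in
theorem unitOfExponents_bijective : Function.Bijective (unitOfExponents K) := by
  rw [Function.bijective_iff_existsUnique]
  intro u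
  obtain ⟨p, hp, hu⟩ := exist_unique_eq_mul_prod K u
  exact ⟨p, hp.symm, fun q hq => hu q hq.symm⟩

variable (J : (Ideal (𝓞 K))⁰)

/-- Ideals in the class inverse to that of `J`. -/
abbrev InverseClass : Type _ := {I : (Ideal (𝓞 K))⁰ // ClassGroup.mk0 I = (ClassGroup.mk0 J)⁻¹}

variable {J}

theorem InverseClass.exists_generator (I : InverseClass J) :
    ∃ x : 𝓞 K, x ≠ 0 ∧ (I.1 : Ideal (𝓞 K)) * J = Ideal.span {x} :=
  ClassGroup.mk0_eq_mk0_inv_iff.mp I.2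

/-- A generator of the principal ideal `I * J`. -/
noncomputable def InverseClass.generator (I : InverseClass J) : 𝓞 K :=
  I.exists_generator.choose

theorem InverseClass.generator_ne_zero (I : InverseClass J) : I.generator ≠ 0 :=
  I.exists_generator.choose_spec.1

theorem InverseClass.mul_eq_span (I : InverseClass J) :
    (I.1 : Ideal (𝓞 K)) * J = Ideal.span {I.generator} :=
  I.exists_generator.choose_spec.2

theorem InverseClass.generator_mem (I : InverseClass J) : I.generator ∈ (J : Ideal (𝓞 K)) := by
  rw [← Ideal.span_singleton_le_iff_mem, ← I.mul_eq_span]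
  exact Ideal.dvd_iff_le.mp (dvd_mul_left _ _)

theorem InverseClass.norm_generator (I : InverseClass J) :
    mixedEmbedding.norm (mixedEmbedding K I.generator) =
      Ideal.absNorm (I.1 : Ideal (𝓞 K)) * Ideal.absNorm (J : Ideal (𝓞 K)) := by
  rw [norm_eq_norm, ← Nat.cast_mul, ← map_mul, I.mul_eq_span, Ideal.absNorm_span_singleton,
    Nat.cast_natAbs, ← Algebra.coe_norm_int]
  push_cast
  rfl

/-- The nonzero elements of `J`, parametrized by ideals of the inverse class and units. -/
noncomputable def InverseClass.element
    (p : InverseClass J × (torsion K × (Fin (rank K) → ℤ))) : (J : Ideal (𝓞 K)) :=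
  ⟨(unitOfExponents K p.2 : 𝓞 K) * p.1.generator,
    Ideal.mul_mem_left (J : Ideal (𝓞 K)) _ p.1.generator_mem⟩

theorem InverseClass.span_element (p : InverseClass J × (torsion K × (Fin (rank K) → ℤ))) :
    Ideal.span {(InverseClass.element p : 𝓞 K)} = (p.1.1 : Ideal (𝓞 K)) * J := by
  rw [InverseClass.element, Ideal.span_singleton_mul_left_unit (Units.isUnit _), p.1.mul_eq_span]

theorem InverseClass.element_injective :
    Function.Injective (InverseClass.element (J := J)) := by
  intro p q hpq
  have hJ : (J : Ideal (𝓞 K)) ≠ 0 := nonZeroDivisors.ne_zero J.2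
  have h1 : p.1 = q.1 := by
    have h := InverseClass.span_element p
    rw [hpq, InverseClass.span_element q] at h
    exact Subtype.ext (Subtype.ext (mul_right_cancel₀ hJ h.symm))
  have h2 := congrArg Subtype.val hpq
  simp only [InverseClass.element, h1] at h2
  have h3 := mul_right_cancel₀ q.1.generator_ne_zero h2
  exact Prod.ext h1 ((unitOfExponents_bijective K).1 (Units.ext h3))

theorem InverseClass.exists_element_eq {x : (J : Ideal (𝓞 K))} (hx : (x : 𝓞 K) ≠ 0) :
    ∃ p, InverseClass.element (J := J) p = x := by
  obtain ⟨I, hI⟩ := Ideal.dvd_span_singleton.mpr x.2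
  have hne : Ideal.span {(x : 𝓞 K)} ≠ 0 := by
    simpa [Ideal.zero_eq_bot, Ideal.span_singleton_eq_bot] using hx
  have hI0 : I ≠ 0 := by
    rintro rfl
    exact hne (by rw [hI, mul_zero])
  let I' : InverseClass J := ⟨⟨I, mem_nonZeroDivisors_of_ne_zero hI0⟩,
    ClassGroup.mk0_eq_mk0_inv_iff.mpr ⟨x, hx, by rw [hI, mul_comm]⟩⟩
  have h : Ideal.span {(I'.generator : 𝓞 K)} = Ideal.span {(x : 𝓞 K)} := by
    rw [← I'.mul_eq_span, hI, mul_comm]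
  obtain ⟨u, hu⟩ := Ideal.span_singleton_eq_span_singleton.mp h
  obtain ⟨p, hp⟩ := (unitOfExponents_bijective K).2 u
  refine ⟨(I', p), Subtype.ext ?_⟩
  simp only [InverseClass.element]
  rw [hp, mul_comm, hu]

theorem coneWeight_element {h : ℝ} (hh : 0 < h)
    (p : InverseClass J × (torsion K × (Fin (rank K) → ℤ))) :
    coneWeight (Ideal.absNorm (J : Ideal (𝓞 K)))
        (h • mixedEmbedding K (InverseClass.element p : 𝓞 K)) =
      dyadicWeight (h ^ finrank ℚ K * Ideal.absNorm (p.1.1 : Ideal (𝓞 K))) *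
        ∏ i, unitBump (unitCoord (mixedEmbedding K p.1.generator) i + p.2.2 i) := by
  have hJ : (Ideal.absNorm (J : Ideal (𝓞 K)) : ℝ) ≠ 0 :=
    Nat.cast_ne_zero.mpr (Ideal.absNorm_ne_zero_of_nonZeroDivisors J)
  have hI : (Ideal.absNorm (p.1.1 : Ideal (𝓞 K)) : ℝ) ≠ 0 :=
    Nat.cast_ne_zero.mpr (Ideal.absNorm_ne_zero_of_nonZeroDivisors p.1.1)
  have hg : mixedEmbedding.norm (mixedEmbedding K p.1.generator) ≠ 0 := by
    rw [InverseClass.norm_generator]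
    exact mul_ne_zero hI hJ
  have he : mixedEmbedding K (InverseClass.element p : 𝓞 K) =
      unitOfExponents K p.2 • mixedEmbedding K p.1.generator := by
    rw [unitSMul_smul, ← map_mul]
    simp [InverseClass.element]
  have hn : mixedEmbedding.norm (mixedEmbedding K (InverseClass.element p : 𝓞 K)) =
      mixedEmbedding.norm (mixedEmbedding K p.1.generator) := by
    rw [he, norm_unit_smul]
  rw [coneWeight_real_smul hh (hn ▸ hg), hn, InverseClass.norm_generator, he, ← mul_assoc,
    mul_div_cancel_right₀ _ hJ]
  congr 1
  exact Finset.prod_congr rfl fun i _ => by rw [unitOfExponents, unitCoord_unit_smul hg]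

theorem tsum_coneWeight_eq {h : ℝ} (hh : 0 < h)
    (hs : Summable fun x : (J : Ideal (𝓞 K)) =>
      coneWeight (Ideal.absNorm (J : Ideal (𝓞 K))) (h • mixedEmbedding K (x : 𝓞 K))) :
    ∑' x : (J : Ideal (𝓞 K)),
        coneWeight (Ideal.absNorm (J : Ideal (𝓞 K))) (h • mixedEmbedding K (x : 𝓞 K)) =
      torsionOrder K * ∑' I : InverseClass J,
        dyadicWeight (h ^ finrank ℚ K * Ideal.absNorm (I.1 : Ideal (𝓞 K))) := by
  have hJ : (0 : ℝ) < Ideal.absNorm (J : Ideal (𝓞 K)) :=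
    Nat.cast_pos.mpr (Ideal.absNorm_pos_of_nonZeroDivisors J)
  have := Fintype.ofFinite (torsion K)
  rw [← InverseClass.element_injective.tsum_eq]
  · have hs' := hs.comp_injective InverseClass.element_injective
    simp only [Function.comp_def, coneWeight_element hh] at hs' ⊢
    rw [hs'.tsum_prod, ← tsum_mul_left]
    refine tsum_congr fun I => ?_
    rw [(hs'.prod_factor I).tsum_prod, tsum_fintype]
    simp only [tsum_mul_left, (hasSum_prod_unitBump _).tsum_eq, mul_one, Finset.sum_const,
      Finset.card_univ, nsmul_eq_mul]
    rw [torsionOrder, Nat.card_eq_fintype_card]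
  · intro x hx
    refine InverseClass.exists_element_eq fun h0 => hx ?_
    simp only [h0, map_zero, smul_zero]
    exact coneWeight_of_norm_le hJ (by rw [map_zero]; positivity)

end Unfolding

/-- The ideal-counting function as a real sequence, with the value at `0` set to `0`. -/
noncomputable def idealCount (K : Type*) [Field K] [NumberField K] (m : ℕ) : ℝ :=
  if m = 0 then 0 else (rK K m : ℝ)

section IdealCount

open nonZeroDivisors

variable (K : Type*) [Field K] [NumberField K]

theorem idealCount_nonneg (m : ℕ) : 0 ≤ idealCount K m := by
  unfold idealCount
  split_ifs <;> positivity

theorem partialSum_idealCount (x : ℝ) :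
    partialSum (idealCount K) x = ∑ m ∈ Finset.Icc 1 ⌊x⌋₊, (rK K m : ℝ) := by
  rw [partialSum, ← Finset.sum_subset
    (Finset.Icc_subset_Icc_left (Nat.zero_le 1) : Finset.Icc 1 ⌊x⌋₊ ⊆ Finset.Icc 0 ⌊x⌋₊)]
  · refine Finset.sum_congr rfl fun m hm => ?_
    rw [idealCount, if_neg (by have := (Finset.mem_Icc.mp hm).1; omega)]
  · intro m hm hm'
    have : m = 0 := by
      simp only [Finset.mem_Icc] at hm hm'
      omega
    simp [idealCount, this]

theorem natCard_absNorm_le_eq_sum (N : ℕ) :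
    Nat.card {I : (Ideal (𝓞 K))⁰ // Ideal.absNorm (I : Ideal (𝓞 K)) ≤ N} =
      ∑ m ∈ Finset.Icc 1 N, rK K m := by
  unfold rK
  rw [← add_left_inj 1, ← Ideal.card_norm_le_eq_card_norm_le_add_one,
    show Finset.Icc 1 N = Finset.Ioc 0 N from Finset.Icc_succ_left_eq_Ioc _ _,
    show 1 = Nat.card {I : Ideal (𝓞 K) // Ideal.absNorm I = 0} by
      simp [Ideal.absNorm_eq_zero_iff],
    Finset.sum_Ioc_add_eq_sum_Icc (N.zero_le),
    ← Finset.card_preimage_eq_sum_card_image_eq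
      (fun k _ => Ideal.finite_setOfPred_absNorm_eq k)]
  simp [Set.coe_eq_subtype]

theorem tendsto_partialSum_idealCount_div :
    Tendsto (fun x : ℝ => partialSum (idealCount K) x / x) atTop
      (nhds (dedekindZeta_residue K)) := by
  refine (NumberField.Ideal.tendsto_norm_le_div_atTop₀ K).congr' ?_
  filter_upwards [eventually_ge_atTop 0] with x hx
  simp_rw [← Nat.le_floor_iff hx]
  rw [natCard_absNorm_le_eq_sum, partialSum_idealCount]
  push_cast
  rfl

theorem tendsto_sub_one_mul_tsum_rK :
    Tendsto (fun s : ℝ => (s - 1) * ∑' m : ℕ, (rK K m : ℝ) / (m : ℝ) ^ s)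
      (nhdsWithin 1 (Ioi 1)) (nhds (dedekindZeta_residue K)) := by
  have h := tendsto_sub_one_mul_dedekindZeta_nhdsGT K
  have h' := (Complex.continuous_re.tendsto _).comp h
  rw [Complex.ofReal_re] at h'
  refine h'.congr' ?_
  filter_upwards [self_mem_nhdsWithin] with s hs
  have hs : 1 < s := hs
  have : dedekindZeta K s = ((∑' m : ℕ, (rK K m : ℝ) / (m : ℝ) ^ s : ℝ) : ℂ) := by
    rw [dedekindZeta, LSeries, Complex.ofReal_tsum]
    refine tsum_congr fun m => ?_
    rcases Nat.eq_zero_or_pos m with rfl | hm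
    · simp [Real.zero_rpow (by linarith : s ≠ 0)]
    · rw [LSeries.term_of_ne_zero hm.ne', Complex.ofReal_div, Complex.ofReal_cpow (by positivity)]
      simp [rK]
  simp only [Function.comp_apply, this]
  rw [← Complex.ofReal_one, ← Complex.ofReal_sub, ← Complex.ofReal_mul, Complex.ofReal_re]

end IdealCount

section IdealLattice

open NumberField.InfinitePlace NumberField.mixedEmbedding NumberField.Units Module nonZeroDivisors

open scoped Classical

variable {K : Type*} [Field K] [NumberField K] (J : (Ideal (𝓞 K))⁰)

/-- An ideal of `𝓞 K` identified with the associated fractional ideal. -/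
noncomputable def idealEquivFractionalIdeal :
    (J : Ideal (𝓞 K)) ≃ (FractionalIdeal.mk0 K J : FractionalIdeal (𝓞 K)⁰ K) :=
  Equiv.ofBijective
    (fun x => ⟨(x : 𝓞 K), (FractionalIdeal.mem_coeIdeal _).mpr ⟨x, x.2, rfl⟩⟩)
    ⟨fun x y h => by
      have hxy : ((x : 𝓞 K) : K) = ((y : 𝓞 K) : K) := by injection h
      exact Subtype.ext (RingOfIntegers.ext hxy), fun y => by
      obtain ⟨x, hx, hxy⟩ := (FractionalIdeal.mem_coeIdeal _).mp y.2
      exact ⟨⟨x, hx⟩, Subtype.ext hxy⟩⟩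

/-- Integral coordinates on the ideal `J`. -/
noncomputable def idealCoordEquiv :
    (Free.ChooseBasisIndex ℤ (FractionalIdeal.mk0 K J : FractionalIdeal (𝓞 K)⁰ K) → ℤ) ≃
      (J : Ideal (𝓞 K)) :=
  (fractionalIdealBasis K (FractionalIdeal.mk0 K J)).equivFun.symm.toEquiv.trans
    (idealEquivFractionalIdeal J).symm

theorem mixedEmbedding_idealCoordEquiv
    (k : Free.ChooseBasisIndex ℤ (FractionalIdeal.mk0 K J : FractionalIdeal (𝓞 K)⁰ K) → ℤ) :
    mixedEmbedding K (idealCoordEquiv J k : 𝓞 K) =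
      (fractionalIdealLatticeBasis K (FractionalIdeal.mk0 K J)).equivFun.symm
        (fun i => (k i : ℝ)) := by
  have h : ((idealCoordEquiv J k : 𝓞 K) : K) =
      ∑ i, k i • basisOfFractionalIdeal K (FractionalIdeal.mk0 K J) i := by
    have h1 : idealEquivFractionalIdeal J (idealCoordEquiv J k) =
        (fractionalIdealBasis K (FractionalIdeal.mk0 K J)).equivFun.symm k :=
      (idealEquivFractionalIdeal J).apply_symm_apply _
    have h2 := congrArg Subtype.val h1
    rw [Basis.equivFun_symm_apply] at h2
    simp_rw [basisOfFractionalIdeal_apply]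
    refine h2.trans ?_
    push_cast
    rfl
  rw [h, map_sum, Basis.equivFun_symm_apply]
  refine Finset.sum_congr rfl fun i _ => ?_
  rw [map_zsmul, fractionalIdealLatticeBasis_apply, Int.cast_smul_eq_zsmul]

/-- The cone weight in the coordinates of the lattice attached to `J`. -/
noncomputable def idealWeight :
    (Free.ChooseBasisIndex ℤ (FractionalIdeal.mk0 K J : FractionalIdeal (𝓞 K)⁰ K) → ℝ) → ℝ :=
  fun v => coneWeight (Ideal.absNorm (J : Ideal (𝓞 K)))
    ((fractionalIdealLatticeBasis K (FractionalIdeal.mk0 K J)).equivFun.symm v)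

theorem contDiff_idealWeight : ContDiff ℝ 3 (idealWeight J) := by
  have hJ : (0 : ℝ) < Ideal.absNorm (J : Ideal (𝓞 K)) :=
    Nat.cast_pos.mpr (Ideal.absNorm_pos_of_nonZeroDivisors J)
  exact (contDiff_coneWeight hJ (m := 3)).comp
    (fractionalIdealLatticeBasis K
      (FractionalIdeal.mk0 K J)).equivFun.toContinuousLinearEquiv.symm.contDiff

theorem hasCompactSupport_idealWeight : HasCompactSupport (idealWeight J) := by
  have hJ : (0 : ℝ) < Ideal.absNorm (J : Ideal (𝓞 K)) :=
    Nat.cast_pos.mpr (Ideal.absNorm_pos_of_nonZeroDivisors J)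
  exact (hasCompactSupport_coneWeight hJ).comp_homeomorph
    (fractionalIdealLatticeBasis K
      (FractionalIdeal.mk0 K J)).equivFun.toContinuousLinearEquiv.symm.toHomeomorph

theorem idealWeight_smul_intCast (h : ℝ)
    (k : Free.ChooseBasisIndex ℤ (FractionalIdeal.mk0 K J : FractionalIdeal (𝓞 K)⁰ K) → ℤ) :
    idealWeight J (h • fun i => (k i : ℝ)) = coneWeight (Ideal.absNorm (J : Ideal (𝓞 K)))
      (h • mixedEmbedding K (idealCoordEquiv J k : 𝓞 K)) := by
  rw [idealWeight, map_smul, mixedEmbedding_idealCoordEquiv]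

theorem latticeSum_idealWeight {h : ℝ} (hh : 0 < h) :
    latticeSum (idealWeight J) h = torsionOrder K * ∑' I : InverseClass J,
        dyadicWeight (h ^ finrank ℚ K * Ideal.absNorm (I.1 : Ideal (𝓞 K))) := by
  obtain ⟨R, hR⟩ := (hasCompactSupport_idealWeight J).isBounded.exists_norm_le
  have hs := summable_lattice
    (fun x hx => hR x (subset_tsupport _ hx)) hh 0
  simp only [add_zero, idealWeight_smul_intCast] at hs
  rw [← tsum_coneWeight_eq hh ((idealCoordEquiv J).summable_iff.mp hs), latticeSum]
  simp only [idealWeight_smul_intCast]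
  exact (idealCoordEquiv J).tsum_eq fun x : (J : Ideal (𝓞 K)) =>
    coneWeight (Ideal.absNorm (J : Ideal (𝓞 K))) (h • mixedEmbedding K (x : 𝓞 K))

theorem card_idealCoord :
    Fintype.card (Free.ChooseBasisIndex ℤ
      (FractionalIdeal.mk0 K J : FractionalIdeal (𝓞 K)⁰ K)) = finrank ℚ K := by
  rw [← finrank_eq_card_chooseBasisIndex, fractionalIdeal_rank, RingOfIntegers.rank]

end IdealLattice

theorem tsum_eq_tsum_fiber {α β : Type*} {f : α → ℝ} (hf : Summable f) (g : α → β) :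
    ∑' a, f a = ∑' b, ∑' a : {a // g a = b}, f a := by
  have h := (Equiv.sigmaFiberEquiv g).summable_iff.mpr hf
  rw [← (Equiv.sigmaFiberEquiv g).tsum_eq f]
  exact h.tsum_sigma

section DyadicSum

open NumberField.Units Module nonZeroDivisors

variable (K : Type*) [Field K] [NumberField K]

theorem summable_dyadicWeight_absNorm {t : ℝ} (ht : 0 < t) :
    Summable fun I : (Ideal (𝓞 K))⁰ => dyadicWeight (t * Ideal.absNorm (I : Ideal (𝓞 K))) := by
  refine summable_of_hasFiniteSupport
    ((Ideal.finite_setOfPred_absNorm_le₀ (S := 𝓞 K) ⌊2 / t⌋₊).subset fun I hI => ?_)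
  refine Nat.le_floor ?_
  by_contra h
  rw [not_le, div_lt_iff₀ ht] at h
  exact hI (dyadicWeight_of_ge (by linarith))

theorem natCard_absNorm_eq (m : ℕ) :
    (Nat.card {I : (Ideal (𝓞 K))⁰ // Ideal.absNorm (I : Ideal (𝓞 K)) = m} : ℝ) =
      idealCount K m := by
  unfold idealCount
  split_ifs with hm
  · have : IsEmpty {I : (Ideal (𝓞 K))⁰ // Ideal.absNorm (I : Ideal (𝓞 K)) = m} :=
      ⟨fun I => Ideal.absNorm_ne_zero_of_nonZeroDivisors I.1 (I.2.trans hm)⟩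
    simp
  · rw [rK, Nat.cast_inj]
    refine Nat.card_congr ⟨fun I => ⟨I.1.1, I.2⟩, fun I => ⟨⟨I.1, ?_⟩, I.2⟩, fun I => rfl,
      fun I => rfl⟩
    refine mem_nonZeroDivisors_of_ne_zero fun h => hm ?_
    rw [← I.2, h, map_zero]

theorem smoothSum_sub_half (r : ℕ → ℝ) {X : ℝ} (hX : 0 < X) :
    smoothSum r X - smoothSum r (X / 2) = ∑' m : ℕ, r m * dyadicWeight (X⁻¹ * m) := by
  have hs : ∀ Y : ℝ, 0 < Y → Summable fun m : ℕ => r m * cutoff (m / Y) := by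
    intro Y hY
    refine summable_of_ne_finset_zero (s := Finset.range (⌊2 * Y⌋₊ + 1)) fun m hm => ?_
    rw [Finset.mem_range, not_lt, Nat.succ_le_iff, Nat.floor_lt (by positivity)] at hm
    rw [cutoff_of_four_thirds_le, mul_zero]
    rw [le_div_iff₀ hY]
    linarith
  rw [smoothSum, smoothSum, ← (hs X hX).tsum_sub (hs (X / 2) (by positivity))]
  refine tsum_congr fun m => ?_
  rw [dyadicWeight, mul_sub]
  congr 3
  · field_simp
  · field_simp

theorem tsum_idealCount_mul {t : ℝ} (ht : 0 < t) :
    ∑' m : ℕ, idealCount K m * dyadicWeight (t * m) =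
      ∑' I : (Ideal (𝓞 K))⁰, dyadicWeight (t * Ideal.absNorm (I : Ideal (𝓞 K))) := by
  rw [tsum_eq_tsum_fiber (summable_dyadicWeight_absNorm K ht)
    fun I => Ideal.absNorm (I : Ideal (𝓞 K))]
  refine tsum_congr fun m => ?_
  rw [tsum_congr fun I : {I : (Ideal (𝓞 K))⁰ // Ideal.absNorm (I : Ideal (𝓞 K)) = m} => by
    rw [I.2], tsum_const, nsmul_eq_mul, natCard_absNorm_eq]

theorem exists_smoothSum_sub_half_eq :
    ∃ J : ClassGroup (𝓞 K) → (Ideal (𝓞 K))⁰, ∀ h : ℝ, 0 < h → ∀ X : ℝ,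
      X = (h ^ finrank ℚ K)⁻¹ →
      smoothSum (idealCount K) X - smoothSum (idealCount K) (X / 2) =
        (torsionOrder K : ℝ)⁻¹ * ∑ C, latticeSum (idealWeight (J C)) h := by
  choose J hJ using fun C : ClassGroup (𝓞 K) => ClassGroup.mk0_surjective C⁻¹
  refine ⟨J, fun h hh X hX => ?_⟩
  have hX0 : 0 < X := by rw [hX]; positivity
  have ht : (torsionOrder K : ℝ) ≠ 0 := Nat.cast_ne_zero.mpr (torsionOrder_ne_zero K)
  rw [smoothSum_sub_half _ hX0, hX, inv_inv, tsum_idealCount_mul K (by positivity),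
    tsum_eq_tsum_fiber (summable_dyadicWeight_absNorm K (by positivity)) ClassGroup.mk0,
    tsum_fintype]
  simp_rw [latticeSum_idealWeight _ hh]
  rw [← Finset.mul_sum, inv_mul_cancel_left₀ ht]
  refine Finset.sum_congr rfl fun C _ => ?_
  unfold InverseClass
  rw [hJ, inv_inv]

theorem exists_abs_smoothSum_sub_le :
    ∃ C, ∀ X : ℝ, 1 ≤ X →
      |(2 : ℝ) ^ finrank ℚ K *
          (smoothSum (idealCount K) X - smoothSum (idealCount K) (X / 2)) -
        (smoothSum (idealCount K) ((2 : ℝ) ^ finrank ℚ K * X) -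
          smoothSum (idealCount K) ((2 : ℝ) ^ finrank ℚ K * X / 2))| ≤
      C * X ^ ((1 : ℝ) - 3 / (finrank ℚ K : ℝ)) := by
  obtain ⟨J, hJ⟩ := exists_smoothSum_sub_half_eq K
  choose c hc using fun C => exists_abs_latticeSum_sub_le (contDiff_idealWeight (J C))
    (hasCompactSupport_idealWeight (J C))
  simp only [card_idealCoord] at hc
  have hn : (0 : ℝ) < finrank ℚ K := Nat.cast_pos.mpr finrank_pos
  refine ⟨(torsionOrder K : ℝ)⁻¹ * ∑ C, c C, fun X hX => ?_⟩
  have hX0 : 0 < X := by linarith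
  set h : ℝ := X ^ (-(1 / (finrank ℚ K : ℝ))) with hdef
  have hh : 0 < h := Real.rpow_pos_of_pos hX0 _
  have hh1 : h ≤ 1 := Real.rpow_le_one_of_one_le_of_nonpos hX (by
    rw [neg_nonpos]; positivity)
  have hhn : h ^ finrank ℚ K = X⁻¹ := by
    rw [hdef, ← Real.rpow_natCast, ← Real.rpow_mul hX0.le, ← Real.rpow_neg_one]
    congr 1
    field_simp
  have hh3 : h ^ 3 / h ^ finrank ℚ K = X ^ ((1 : ℝ) - 3 / (finrank ℚ K : ℝ)) := by
    rw [hhn, hdef, ← Real.rpow_natCast, ← Real.rpow_mul hX0.le, div_inv_eq_mul,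
      ← Real.rpow_add_one hX0.ne']
    congr 1
    push_cast
    ring
  rw [hJ h hh X (by rw [hhn, inv_inv]),
    hJ (h / 2) (by positivity) ((2 : ℝ) ^ finrank ℚ K * X)
      (by rw [div_pow, hhn]; field_simp),
    mul_left_comm, ← mul_sub, Finset.mul_sum, ← Finset.sum_sub_distrib, abs_mul,
    abs_of_nonneg (by positivity : (0 : ℝ) ≤ (torsionOrder K : ℝ)⁻¹), mul_assoc, Finset.sum_mul]
  refine mul_le_mul_of_nonneg_left ?_ (by positivity)
  refine (Finset.abs_sum_le_sum_abs _ _).trans (Finset.sum_le_sum fun C _ => ?_)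
  rw [← hh3]
  exact hc C h hh hh1

end DyadicSum

/-- For a number field of degree `n ≥ 6` there is a constant `C` such that every dyadic
interval `[X, 2X]` with `X ≥ max(d_K^{1/2}, 2)` contains a point `x₀` at which
`∑_{m ≤ x₀} r_K(m) = κ_K x₀ + O(x₀^{1-3/n+ε})` holds with constant `C`. -/
theorem stmt5 (K : Type*) [Field K] [NumberField K]
    (hn : 6 ≤ Module.finrank ℚ K)
    (κ : ℝ)
    (hκ : Filter.Tendsto
      (fun s : ℝ => (s - 1) * ∑' m : ℕ, (rK K m : ℝ) / (m : ℝ) ^ s)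
      (nhdsWithin 1 (Set.Ioi 1)) (nhds κ))
    (ε : ℝ) (hε : 0 < ε) :
    ∃ C > 0, ∀ X : ℝ, max (Real.sqrt |(NumberField.discr K : ℝ)|) 2 ≤ X →
      ∃ x₀ : ℝ, X ≤ x₀ ∧ x₀ ≤ 2 * X ∧
        |(∑ m ∈ Finset.Icc 1 ⌊x₀⌋₊, (rK K m : ℝ)) - κ * x₀|
          ≤ C * x₀ ^ ((1 : ℝ) - 3 / (Module.finrank ℚ K : ℝ) + ε) := by
  obtain rfl := tendsto_nhds_unique hκ (tendsto_sub_one_mul_tsum_rK K)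
  have hn' : (6 : ℝ) ≤ Module.finrank ℚ K := by exact_mod_cast hn
  obtain ⟨A, hA⟩ := exists_abs_smoothSum_sub_le K
  have hdiv : (3 : ℝ) / Module.finrank ℚ K ≤ 1 / 2 := by
    rw [div_le_div_iff₀ (by linarith) two_pos]
    linarith
  have hpow : ((2 : ℝ) ^ Module.finrank ℚ K) ^ ((1 : ℝ) - 3 / (Module.finrank ℚ K : ℝ)) =
      (2 : ℝ) ^ Module.finrank ℚ K / 8 := by
    rw [← Real.rpow_natCast, ← Real.rpow_mul zero_le_two,
      show (Module.finrank ℚ K : ℝ) * (1 - 3 / (Module.finrank ℚ K : ℝ)) =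
        (Module.finrank ℚ K : ℝ) - (3 : ℕ) by field_simp; norm_num,
      Real.rpow_sub two_pos, Real.rpow_natCast _ 3]
    norm_num
  have h64 : (64 : ℝ) ≤ (2 : ℝ) ^ Module.finrank ℚ K :=
    calc (64 : ℝ) = 2 ^ 6 := by norm_num
      _ ≤ _ := pow_le_pow_right₀ one_le_two hn
  obtain ⟨B, hB, h⟩ := exists_abs_partialSum_sub_le_rpow (idealCount_nonneg K)
    (tendsto_partialSum_idealCount_div K) (N := (2 : ℝ) ^ Module.finrank ℚ K)
    (by linarith) (by linarith) (sub_le_self _ (by positivity))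
    (by rw [hpow]; linarith) hA
  refine ⟨B, hB, fun X hX => ?_⟩
  have hX2 : 2 ≤ X := (le_max_right _ _).trans hX
  obtain ⟨x, hx, hx2, hxb⟩ := h X (by linarith)
  refine ⟨x, hx, hx2, ?_⟩
  rw [← partialSum_idealCount]
  refine hxb.trans (mul_le_mul_of_nonneg_left ?_ hB.le)
  exact Real.rpow_le_rpow_of_exponent_le (by linarith) (by linarith)
end

section
/- Let $K$ be an algebraic number field. For every real $x > 1$, $\sum_{m \leq x} r_K(m) \log\frac{x}{m} = \frac{1}{2\pi i} \int_{2 - i\infty}^{2 + i\infty} \frac{\zeta_K(s)}{s^2}\, x^s\, \mathrm{d}s$, where the integral is taken over the vertical line $\mathrm{Re}(s) = 2$. -/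
open NumberField Filter Asymptotics Set MeasureTheory

/-- The Mellin transform of `t ↦ log⁺ t⁻¹` is `s ↦ 1 / s ^ 2` on the right half-plane. -/
lemma hasMellin_posLog_inv {s : ℂ} (hs : 0 < s.re) :
    HasMellin (fun t : ℝ ↦ (Real.posLog t⁻¹ : ℂ)) s (1 / s ^ 2) := by
  have hs0 : s ≠ 0 := by
    rintro rfl
    simp at hs
  set g : ℝ → ℂ := indicator (Ioc 0 1) (fun _ ↦ 1) with hg
  have hloc : LocallyIntegrableOn g (Ioi 0) := by
    refine (((locallyIntegrable_const (1 : ℂ)).mono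
      (aestronglyMeasurable_const.indicator measurableSet_Ioc)
      (Eventually.of_forall fun t ↦ ?_))).locallyIntegrableOn _
    exact norm_indicator_le_norm_self _ _
  have htop : g =O[atTop] (fun t : ℝ ↦ t ^ (-(s.re + 1))) := by
    refine (isBigO_zero _ _).congr' ?_ EventuallyEq.rfl
    filter_upwards [eventually_gt_atTop 1] with t ht
    simp [hg, ht]
  have hbot : g =O[nhdsWithin 0 (Ioi 0)] (fun t : ℝ ↦ t ^ (-(0 : ℝ))) := by
    refine isBigO_of_le _ fun t ↦ ?_
    simpa using norm_indicator_le_norm_self (s := Ioc (0 : ℝ) 1) (fun _ ↦ (1 : ℂ)) t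
  obtain ⟨hconv, hderiv⟩ := mellin_hasDerivAt_of_isBigO_rpow hloc htop (by linarith) hbot hs
  have hderiv' : HasDerivAt (mellin g) (-(s ^ 2)⁻¹) s := by
    refine (hasDerivAt_inv hs0).congr_of_eventuallyEq ?_
    filter_upwards [(isOpen_lt continuous_const Complex.continuous_re).mem_nhds hs] with z hz
    rw [(hasMellin_one_Ioc hz).2, one_div]
  have hfg : EqOn (fun t : ℝ ↦ (-1 : ℂ) • (Real.log t • g t))
      (fun t : ℝ ↦ (Real.posLog t⁻¹ : ℂ)) (Ioi 0) := by
    intro t ht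
    rcases le_or_gt t 1 with h | h
    · have : 0 ≤ Real.log t⁻¹ := Real.log_nonneg ((one_le_inv₀ ht).2 h)
      have ht' : 0 < t := ht
      simp only [hg, indicator_of_mem (show t ∈ Ioc (0 : ℝ) 1 from ⟨ht, h⟩)]
      rw [Real.posLog_apply, max_eq_right this, Real.log_inv]
      simp
    · have : Real.log t⁻¹ ≤ 0 := Real.log_nonpos (inv_nonneg.2 ht.le) (inv_le_one_of_one_le₀ h.le)
      beta_reduce
      rw [Real.posLog_apply, max_eq_left this]
      simp [hg, h]
  have key := hasMellin_const_smul hconv (-1 : ℂ)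
  rw [hderiv.unique hderiv'] at key
  refine ⟨?_, ?_⟩
  · refine key.1.congr_fun (fun t ht ↦ ?_) measurableSet_Ioi
    simp only [← hfg ht]
  · rw [← show (-1 : ℂ) • (-(s ^ 2)⁻¹) = 1 / s ^ 2 by simp, ← key.2]
    refine setIntegral_congr_fun measurableSet_Ioi fun t ht ↦ ?_
    simp only [← hfg ht]

/-- The function `s ↦ 1 / s ^ 2` is integrable on the vertical line `Re s = 2`. -/
lemma integrable_one_div_two_add_mul_I_sq :
    Integrable (fun τ : ℝ ↦ 1 / ((2 : ℂ) + τ * Complex.I) ^ 2) := by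
  have hne (τ : ℝ) : (2 : ℂ) + τ * Complex.I ≠ 0 := fun h ↦ by
    simpa using congrArg Complex.re h
  refine integrable_inv_one_add_sq.mono' ?_ (Eventually.of_forall fun τ ↦ ?_)
  · refine Continuous.aestronglyMeasurable ?_
    exact continuous_const.div (by fun_prop) fun τ ↦ pow_ne_zero 2 (hne τ)
  · rw [norm_div, norm_one, norm_pow, one_div, Complex.sq_norm, Complex.normSq_apply]
    have hre : ((2 : ℂ) + τ * Complex.I).re = 2 := by simp
    have him : ((2 : ℂ) + τ * Complex.I).im = τ := by simp
    rw [hre, him]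
    exact inv_anti₀ (by positivity) (by nlinarith)

/-- **Perron's formula** for a single term: on the line `Re s = 2`, the integral of `y ^ s / s ^ 2`
is `2 π log⁺ y`. -/
lemma integral_cpow_neg_div_sq {y : ℝ} (hy : 0 < y) :
    (1 / (2 * Real.pi) : ℂ) * ∫ τ : ℝ,
      (y : ℂ) ^ (-((2 : ℂ) + τ * Complex.I)) * (1 / ((2 : ℂ) + τ * Complex.I) ^ 2)
      = (Real.posLog y⁻¹ : ℂ) := by
  have hmel (τ : ℝ) : mellin (fun t : ℝ ↦ (Real.posLog t⁻¹ : ℂ)) ((2 : ℝ) + τ * Complex.I)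
      = 1 / ((2 : ℂ) + τ * Complex.I) ^ 2 := by
    rw [(hasMellin_posLog_inv (by simp)).2, Complex.ofReal_ofNat]
  have h := mellinInv_mellin_eq 2 (fun t : ℝ ↦ (Real.posLog t⁻¹ : ℂ)) hy
    (hasMellin_posLog_inv (by simp)).1 (by
      refine integrable_one_div_two_add_mul_I_sq.congr (Eventually.of_forall fun τ ↦ ?_)
      exact (hmel τ).symm)
    (Complex.continuous_ofReal.continuousAt.comp
      (Real.continuous_posLog.continuousAt.comp (continuousAt_inv₀ hy.ne')))
  rw [← h, mellinInv]
  simp only [hmel, smul_eq_mul, Complex.real_smul]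
  push_cast
  rfl

/-- The Dirichlet series of the Dedekind zeta function converges absolutely at `s = 2`. -/
lemma summable_rK_div_sq (K : Type*) [Field K] [NumberField K] :
    Summable fun m : ℕ ↦ (rK K m : ℝ) / (m : ℝ) ^ 2 := by
  have hO : (fun n : ℕ ↦ ∑ k ∈ Finset.Icc 1 n, (rK K k : ℝ)) =O[atTop]
      fun n ↦ (n : ℝ) ^ (1 : ℝ) := by
    refine isBigO_atTop_natCast_rpow_of_tendsto_div_rpow (𝕜 := ℝ)
      (a := dedekindZeta_residue K) ?_
    simp only [Real.rpow_one]
    refine ((Ideal.tendsto_norm_le_div_atTop₀ K).comp tendsto_natCast_atTop_atTop).congr fun n ↦ ?_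
    simp only [Function.comp_apply, Nat.cast_le, ← Nat.cast_sum, rK]
    congr
    rw [← add_left_inj 1, ← Ideal.card_norm_le_eq_card_norm_le_add_one,
      show Finset.Icc 1 n = Finset.Ioc 0 n from Finset.Icc_succ_left_eq_Ioc _ _,
      show 1 = Nat.card {I : Ideal (𝓞 K) // Ideal.absNorm I = 0} by
        simp [Ideal.absNorm_eq_zero_iff],
      Finset.sum_Ioc_add_eq_sum_Icc (n.zero_le),
      ← Finset.card_preimage_eq_sum_card_image_eq
        (fun k _ ↦ Ideal.finite_setOfPred_absNorm_eq k)]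
    simp [Set.coe_eq_subtype]
  have h := LSeriesSummable_of_sum_norm_bigO_and_nonneg (s := 2) hO
    (fun _ ↦ Nat.cast_nonneg _) zero_le_one (by simp)
  refine (summable_norm_iff.2 h).congr fun m ↦ ?_
  rcases eq_or_ne m 0 with rfl | hm
  · simp
  · rw [LSeries.term_of_ne_zero hm]
    simp

/-- Perron-type formula: for `x > 1`,
`∑_{m≤x} r_K(m) log(x/m) = (1/(2πi))∫_{(2)} ζ_K(s) x^s / s² ds`,
written as the absolutely convergent integral over the vertical line `Re s = 2`,
where on this line `ζ_K(s) = ∑_{m≥1} r_K(m) m^{-s}`. -/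
theorem stmt9 (K : Type*) [Field K] [NumberField K] (x : ℝ) (hx : 1 < x) :
    ((∑ m ∈ Finset.Icc 1 ⌊x⌋₊, (rK K m : ℝ) * Real.log (x / m) : ℝ) : ℂ)
      = (1 / (2 * Real.pi)) * ∫ τ : ℝ,
          (∑' m : ℕ, (rK K m : ℂ) / (m : ℂ) ^ ((2 : ℂ) + τ * Complex.I))
            / ((2 : ℂ) + τ * Complex.I) ^ 2
            * (x : ℂ) ^ ((2 : ℂ) + τ * Complex.I) := by
  have hx0 : 0 < x := by linarith
  have hne (τ : ℝ) : (2 : ℂ) + τ * Complex.I ≠ 0 := fun h ↦ by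
    simpa using congrArg Complex.re h
  set F : ℕ → ℝ → ℂ := fun m τ ↦ (rK K m : ℂ) / (m : ℂ) ^ ((2 : ℂ) + τ * Complex.I)
    / ((2 : ℂ) + τ * Complex.I) ^ 2 * (x : ℂ) ^ ((2 : ℂ) + τ * Complex.I) with hF
  have hF0 (τ : ℝ) : F 0 τ = 0 := by simp [hF, Complex.zero_cpow (hne τ)]
  have hF_eq {m : ℕ} (hm : m ≠ 0) (τ : ℝ) : F m τ = (rK K m : ℂ) *
      (((m / x : ℝ) : ℂ) ^ (-((2 : ℂ) + τ * Complex.I)) *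
        (1 / ((2 : ℂ) + τ * Complex.I) ^ 2)) := by
    have hxs : (x : ℂ) ^ ((2 : ℂ) + τ * Complex.I) ≠ 0 := by
      simp [Complex.cpow_eq_zero_iff, hx0.ne']
    have hms : (m : ℂ) ^ ((2 : ℂ) + τ * Complex.I) ≠ 0 := by
      simp [Complex.cpow_eq_zero_iff, hm]
    have hmul : ((m / x : ℝ) : ℂ) ^ ((2 : ℂ) + τ * Complex.I)
        * (x : ℂ) ^ ((2 : ℂ) + τ * Complex.I) = (m : ℂ) ^ ((2 : ℂ) + τ * Complex.I) := by
      rw [← Complex.mul_cpow_ofReal_nonneg (by positivity) hx0.le, ← Complex.ofReal_mul,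
        div_mul_cancel₀ _ hx0.ne', Complex.ofReal_natCast]
    rw [Complex.cpow_neg, eq_div_of_mul_eq hxs hmul]
    have := hne τ
    simp only [hF]
    field_simp
  have hF_norm (m : ℕ) (τ : ℝ) : ‖F m τ‖ =
      (rK K m : ℝ) / (m : ℝ) ^ 2 * x ^ 2 * ‖1 / ((2 : ℂ) + τ * Complex.I) ^ 2‖ := by
    rcases eq_or_ne m 0 with rfl | hm
    · simp [hF0]
    · have hm0 : 0 < m := Nat.pos_of_ne_zero hm
      simp only [hF, norm_mul, norm_div, Complex.norm_natCast,
        Complex.norm_natCast_cpow_of_pos hm0, Complex.norm_cpow_eq_rpow_re_of_pos hx0]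
      simp
      ring
  have hF_int (m : ℕ) : Integrable (F m) := by
    refine (integrable_one_div_two_add_mul_I_sq.norm.const_mul
      ((rK K m : ℝ) / (m : ℝ) ^ 2 * x ^ 2)).mono' ?_
      (Eventually.of_forall fun τ ↦ (hF_norm m τ).le)
    rcases eq_or_ne m 0 with rfl | hm
    · rw [funext hF0]
      exact aestronglyMeasurable_const
    · refine Continuous.aestronglyMeasurable ?_
      refine ((continuous_const.div ?_ fun τ ↦ ?_).div (by fun_prop)
        fun τ ↦ pow_ne_zero 2 (hne τ)).mul ?_
      · exact Continuous.const_cpow (by fun_prop) (Or.inl (by exact_mod_cast hm))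
      · simp [Complex.cpow_eq_zero_iff, hm]
      · exact Continuous.const_cpow (by fun_prop) (Or.inl (by exact_mod_cast hx0.ne'))
  have hF_sum : Summable fun m ↦ ∫ τ, ‖F m τ‖ := by
    simp only [hF_norm, integral_const_mul]
    exact ((summable_rK_div_sq K).mul_right _).mul_right _
  have hterm {m : ℕ} (hm : m ≠ 0) : (1 / (2 * Real.pi) : ℂ) * ∫ τ, F m τ
      = (rK K m : ℂ) * (Real.posLog (x / m) : ℂ) := by
    simp only [hF_eq hm]
    rw [integral_const_mul, mul_left_comm, integral_cpow_neg_div_sq (by positivity), inv_div]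
  calc ((∑ m ∈ Finset.Icc 1 ⌊x⌋₊, (rK K m : ℝ) * Real.log (x / m) : ℝ) : ℂ)
      = ∑ m ∈ Finset.Icc 1 ⌊x⌋₊, (1 / (2 * Real.pi) : ℂ) * ∫ τ, F m τ := by
        rw [Complex.ofReal_sum]
        refine Finset.sum_congr rfl fun m hm ↦ ?_
        obtain ⟨hm1, hm2⟩ := Finset.mem_Icc.1 hm
        have hmx : (m : ℝ) ≤ x := (Nat.le_floor_iff hx0.le).1 hm2
        have hm0 : (0 : ℝ) < m := by exact_mod_cast hm1
        have hlog : 0 ≤ Real.log (x / m) := Real.log_nonneg ((one_le_div hm0).2 hmx)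
        rw [hterm (by lia), Real.posLog_apply, max_eq_right hlog]
        push_cast
        rfl
    _ = ∑' m, (1 / (2 * Real.pi) : ℂ) * ∫ τ, F m τ := by
        refine (tsum_eq_sum fun m hm ↦ ?_).symm
        rcases eq_or_ne m 0 with rfl | hm0
        · simp [hF0]
        · have hmx : x < m := by
            rw [Finset.mem_Icc, not_and, not_le] at hm
            exact (Nat.floor_lt hx0.le).1 (hm (Nat.one_le_iff_ne_zero.2 hm0))
          have hlog : Real.log (x / m) ≤ 0 :=
            Real.log_nonpos (by positivity) (div_le_one_of_le₀ hmx.le (by positivity))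
          rw [hterm hm0, Real.posLog_apply, max_eq_left hlog]
          simp
    _ = (1 / (2 * Real.pi) : ℂ) * ∫ τ, ∑' m, F m τ := by
        rw [tsum_mul_left, integral_tsum_of_summable_integral_norm hF_int hF_sum]
    _ = _ := by simp only [hF, tsum_mul_right, tsum_div_const]
end
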